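/- arXiv:1007.2964 — 3 statements merged into one kernel-verified Lean document; each statement's English description precedes it below -/
import Mathlib

section
/- Let 𝒳 be a complete separable metric space, let F be a countable family of Borel measurable functions f : 𝒳 → [0,1], and let X₁, X₂, … be a stationary ergodic process with values in 𝒳 (modeled as Xᵢ = ξ ∘ Tⁱ for an ergodic measure-preserving map T on a probability space (Ω, μ) and a measurable ξ : Ω → 𝒳). If there exists η > 0 such that for μ-almost every ω, limsup_{m→∞} Γ_m(F)(ω) > η, then for every γ with 0 < γ ≤ η/10 the gap dimension of F at resolution γ is infinite, i.e., for every k ∈ ℕ the family F γ-shatters some finite subset of 𝒳 of cardinality k. -/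
open MeasureTheory Filter

/-- The `m`-sample discrepancy of the family `F` at the sample point `ω`, for the
process `Xᵢ = ξ ∘ Tⁱ`. -/
noncomputable def discrepancy {Ω X : Type*} [MeasurableSpace Ω] (μ : Measure Ω)
    (T : Ω → Ω) (ξ : Ω → X) (F : Set (X → ℝ)) (m : ℕ) (ω : Ω) : ℝ :=
  ⨆ f : F, |(1 / (m : ℝ)) * ∑ i ∈ Finset.Icc 1 m, (f : X → ℝ) (ξ (T^[i] ω)) -
      ∫ x, (f : X → ℝ) (ξ x) ∂μ|

/-- `F` γ-shatters the finite set `D`. -/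
def GammaShatters {X : Type*} (F : Set (X → ℝ)) (γ : ℝ) (D : Finset X) : Prop :=
  ∃ α : ℝ, ∀ D₀ ⊆ D, ∃ f ∈ F,
    (∀ x ∈ D₀, f x > α + γ) ∧ (∀ x ∈ D, x ∉ D₀ → f x < α - γ)

/-- The running maximum `max_{0 ≤ k ≤ n} ∑_{i < k} g ∘ Tⁱ` of the Birkhoff sums of `g`. -/
noncomputable def birkhoffMax {Ω : Type*} (T : Ω → Ω) (g : Ω → ℝ) : ℕ → Ω → ℝ
  | 0 => fun _ => 0
  | n + 1 => fun ω => max 0 (g ω + birkhoffMax T g n (T ω))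

section BirkhoffMax

variable {Ω : Type*} {T : Ω → Ω} {g : Ω → ℝ}

theorem birkhoffMax_succ (n : ℕ) (ω : Ω) :
    birkhoffMax T g (n + 1) ω = max 0 (g ω + birkhoffMax T g n (T ω)) := rfl

theorem birkhoffMax_nonneg (n : ℕ) (ω : Ω) : 0 ≤ birkhoffMax T g n ω := by
  cases n with
  | zero => exact le_rfl
  | succ n => exact le_max_left _ _

theorem birkhoffMax_le_succ (n : ℕ) (ω : Ω) :
    birkhoffMax T g n ω ≤ birkhoffMax T g (n + 1) ω := by
  induction n generalizing ω with
  | zero => exact birkhoffMax_nonneg _ _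
  | succ n ih =>
    rw [birkhoffMax_succ, birkhoffMax_succ]
    have := ih (T ω)
    gcongr

theorem birkhoffMax_mono (ω : Ω) : Monotone fun n => birkhoffMax T g n ω :=
  monotone_nat_of_le_succ fun n => birkhoffMax_le_succ n ω

theorem birkhoffSum_le_birkhoffMax (n : ℕ) (ω : Ω) :
    birkhoffSum T g n ω ≤ birkhoffMax T g n ω := by
  induction n generalizing ω with
  | zero => simp [birkhoffMax]
  | succ n ih =>
    rw [birkhoffSum_succ', birkhoffMax_succ]
    exact le_max_of_le_right (by linarith [ih (T ω)])

theorem birkhoffMax_le_mul {K : ℝ} (hK : ∀ ω, |g ω| ≤ K) (n : ℕ) (ω : Ω) :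
    birkhoffMax T g n ω ≤ n * K := by
  induction n generalizing ω with
  | zero => simp [birkhoffMax]
  | succ n ih =>
    have h1 := ih (T ω)
    have h2 := hK ω
    have h3 := abs_nonneg (g ω)
    have h4 := le_abs_self (g ω)
    rw [birkhoffMax_succ]
    push_cast
    have h5 : 0 ≤ (n : ℝ) * K := mul_nonneg n.cast_nonneg (h3.trans h2)
    exact max_le (by linarith) (by linarith)

theorem bddAbove_birkhoffMax_comp_iff (ω : Ω) :
    BddAbove (Set.range fun n => birkhoffMax T g n (T ω)) ↔
      BddAbove (Set.range fun n => birkhoffMax T g n ω) := by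
  constructor
  · rintro ⟨C, hC⟩
    refine ⟨max 0 (g ω + C), ?_⟩
    rintro _ ⟨n, rfl⟩
    refine (birkhoffMax_le_succ n ω).trans ?_
    rw [birkhoffMax_succ]
    have := hC ⟨n, rfl⟩
    dsimp only at this
    gcongr
  · rintro ⟨C, hC⟩
    refine ⟨C - g ω, ?_⟩
    rintro _ ⟨n, rfl⟩
    have h1 := hC ⟨n + 1, rfl⟩
    have h2 := le_max_right 0 (g ω + birkhoffMax T g n (T ω))
    dsimp only at h1 ⊢
    rw [birkhoffMax_succ] at h1
    linarith

theorem measurable_birkhoffMax [MeasurableSpace Ω] (hT : Measurable T) (hg : Measurable g)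
    (n : ℕ) : Measurable (birkhoffMax T g n) := by
  induction n with
  | zero => exact measurable_const
  | succ n ih => exact measurable_const.max (hg.add (ih.comp hT))

/-- If the Birkhoff sums of `g` are almost surely unbounded above, then `g` has nonnegative
integral. -/
theorem integral_nonneg_of_birkhoffMax_unbounded [MeasurableSpace Ω] {μ : Measure Ω}
    [IsProbabilityMeasure μ] (hT : MeasurePreserving T μ μ) (hg : Measurable g) {K : ℝ}
    (hK : ∀ ω, |g ω| ≤ K)
    (h : ∀ᵐ ω ∂μ, ¬ BddAbove (Set.range fun n => birkhoffMax T g n (T ω))) :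
    0 ≤ ∫ ω, g ω ∂μ := by
  have hm := measurable_birkhoffMax hT.measurable hg
  have hint (n : ℕ) : Integrable (birkhoffMax T g n) μ :=
    .of_bound (hm n).aestronglyMeasurable (n * K) (.of_forall fun ω => by
      rw [Real.norm_of_nonneg (birkhoffMax_nonneg n ω)]
      exact birkhoffMax_le_mul hK n ω)
  have hcomp (n : ℕ) : Integrable (fun ω => birkhoffMax T g n (T ω)) μ :=
    (hT.integrable_comp (hm n).aestronglyMeasurable).2 (hint n)
  have hdiff (n : ℕ) (ω : Ω) : birkhoffMax T g (n + 1) ω - birkhoffMax T g n (T ω) =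
      max (-birkhoffMax T g n (T ω)) (g ω) := by
    rw [birkhoffMax_succ, ← max_sub_sub_right]
    congr 1 <;> ring
  have hlim : Tendsto
      (fun n => ∫ ω, (birkhoffMax T g (n + 1) ω - birkhoffMax T g n (T ω)) ∂μ) atTop
      (nhds (∫ ω, g ω ∂μ)) := by
    refine tendsto_integral_of_dominated_convergence (fun _ => K)
      (fun n => ((hint _).sub (hcomp n)).aestronglyMeasurable) (integrable_const K) ?_ ?_
    · refine fun n => .of_forall fun ω => ?_
      have h1 := abs_le.1 (hK ω)
      have h2 := birkhoffMax_nonneg (T := T) (g := g) n (T ω)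
      rw [hdiff, Real.norm_eq_abs, abs_le]
      exact ⟨h1.1.trans (le_max_right _ _), max_le (by linarith) h1.2⟩
    · filter_upwards [h] with ω hω
      refine tendsto_const_nhds.congr' ?_
      obtain ⟨_, ⟨N, rfl⟩, hN⟩ := not_bddAbove_iff.1 hω (-g ω)
      filter_upwards [eventually_ge_atTop N] with n hn
      rw [hdiff, max_eq_right]
      have := birkhoffMax_mono (T := T) (g := g) (T ω) hn
      dsimp only at this hN
      linarith
  refine ge_of_tendsto' hlim fun n => ?_
  rw [integral_sub (hint _) (hcomp n), sub_nonneg]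
  calc ∫ ω, birkhoffMax T g n (T ω) ∂μ = ∫ ω, birkhoffMax T g n ω ∂μ := by
        rw [← integral_map hT.measurable.aemeasurable (hm n).aestronglyMeasurable, hT.map_eq]
    _ ≤ _ := integral_mono (hint n) (hint _) (birkhoffMax_le_succ n)

/-- The upper half of Birkhoff's pointwise ergodic theorem for bounded functions. -/
theorem Ergodic.ae_eventually_birkhoffSum_le [MeasurableSpace Ω] {μ : Measure Ω}
    [IsProbabilityMeasure μ] (hT : Ergodic T μ) (hg : Measurable g) {K : ℝ}
    (hK : ∀ ω, |g ω| ≤ K) {c : ℝ} (hc : ∫ ω, g ω ∂μ < c) :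
    ∀ᵐ ω ∂μ, ∀ᶠ n : ℕ in atTop, birkhoffSum T g n ω ≤ n * c := by
  obtain ⟨d, hgd, hdc⟩ := exists_between hc
  have hint : Integrable g μ := .of_bound hg.aestronglyMeasurable K (.of_forall hK)
  set G : Ω → ℝ := fun ω => g ω - d with hG
  have hGm : Measurable G := hg.sub_const d
  have hGK (ω : Ω) : |G ω| ≤ K + |d| := (abs_sub _ _).trans (by gcongr; exact hK ω)
  set E : Set Ω := {ω | BddAbove (Set.range fun n => birkhoffMax T G n ω)}
  have hEm : MeasurableSet E :=
    measurableSet_bddAbove_range (measurable_birkhoffMax hT.measurable hGm)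
  have hEinv : T ⁻¹' E = E := Set.ext fun ω => bddAbove_birkhoffMax_comp_iff ω
  rcases hT.toPreErgodic.ae_mem_or_ae_notMem hEm hEinv with h | h
  · filter_upwards [h] with ω ⟨C, hC⟩
    have hlin : Tendsto (fun n : ℕ => (n : ℝ) * (c - d)) atTop atTop :=
      tendsto_natCast_atTop_atTop.atTop_mul_const (sub_pos.2 hdc)
    filter_upwards [hlin.eventually_ge_atTop C] with n hn
    have h1 := (birkhoffSum_le_birkhoffMax n ω).trans (hC ⟨n, rfl⟩)
    have h2 : birkhoffSum T G n ω = birkhoffSum T g n ω - n * d := by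
      simp [hG, birkhoffSum]
    linarith
  · have := integral_nonneg_of_birkhoffMax_unbounded hT.toMeasurePreserving hGm hGK
      (h.mono fun ω hω hb => hω ((bddAbove_birkhoffMax_comp_iff ω).1 hb))
    rw [hG, integral_sub hint (integrable_const d)] at this
    simp at this
    linarith

end BirkhoffMax

/-- For an ergodic process, the upper half of the law of large numbers for bounded observables. -/
theorem Ergodic.ae_eventually_sum_Icc_le {Ω X : Type*} [MeasurableSpace Ω] [MeasurableSpace X]
    {μ : Measure Ω} [IsProbabilityMeasure μ] {T : Ω → Ω} {ξ : Ω → X} (hT : Ergodic T μ)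
    (hξ : Measurable ξ) {u : X → ℝ} (hu : Measurable u) {K : ℝ} (hK : ∀ x, |u x| ≤ K) {c : ℝ}
    (hc : ∫ ω, u (ξ ω) ∂μ < c) :
    ∀ᵐ ω ∂μ, ∀ᶠ m : ℕ in atTop, ∑ i ∈ Finset.Icc 1 m, u (ξ (T^[i] ω)) ≤ m * c := by
  have hint : ∫ ω, u (ξ (T ω)) ∂μ < c := by
    rwa [← integral_map (f := fun ω => u (ξ ω)) hT.measurable.aemeasurable
      (hu.comp hξ).aestronglyMeasurable, hT.map_eq]
  filter_upwards [hT.ae_eventually_birkhoffSum_le (hu.comp (hξ.comp hT.measurable))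
    (fun ω => hK _) hint] with ω hω
  filter_upwards [hω] with m hm
  convert hm using 1
  rw [birkhoffSum, ← Finset.Ico_add_one_right_eq_Icc, Finset.sum_Ico_eq_sum_range]
  refine Finset.sum_congr (by simp) fun i _ => ?_
  rw [add_comm, Function.iterate_succ_apply']
  rfl

/-- The points at which the subfamily `G` takes values both above `α + γ` and below `α - γ`. -/
def oscillationSet {ι X : Type*} (f : ι → X → ℝ) (γ α : ℝ) (G : Set ι) : Set X :=
  {x | (∃ i ∈ G, α + γ < f i x) ∧ ∃ i ∈ G, f i x < α - γ}

section Oscillation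

variable {ι X : Type*} {f : ι → X → ℝ} {γ α : ℝ}

theorem oscillationSet_mono : Monotone (oscillationSet f γ α) := by
  rintro G H hGH x ⟨⟨i, hi, hix⟩, j, hj, hjx⟩
  exact ⟨⟨i, hGH hi, hix⟩, j, hGH hj, hjx⟩

theorem measurableSet_oscillationSet [MeasurableSpace X] [Countable ι]
    (hf : ∀ i, Measurable (f i)) (G : Set ι) : MeasurableSet (oscillationSet f γ α G) := by
  have : oscillationSet f γ α G =
      (⋃ i ∈ G, {x | α + γ < f i x}) ∩ ⋃ i ∈ G, {x | f i x < α - γ} := by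
    ext x; simp [oscillationSet]
  rw [this]
  exact (MeasurableSet.biUnion G.to_countable fun i _ =>
    measurableSet_lt measurable_const (hf i)).inter
    (MeasurableSet.biUnion G.to_countable fun i _ => measurableSet_lt (hf i) measurable_const)

/-- Outside the oscillation sets at the levels `j γ`, the family `G` varies by at most `4 γ`. -/
theorem sub_le_of_notMem_oscillationSet (hγ : 0 < γ) (hfb : ∀ i x, f i x ∈ Set.Icc (0 : ℝ) 1)
    {G : Set ι} {N : ℕ} (hN : 1 ≤ N * γ) {x : X}
    (hx : ∀ j < N, x ∉ oscillationSet f γ (j * γ) G) {i i' : ι} (hi : i ∈ G) (hi' : i' ∈ G) :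
    f i x - f i' x ≤ 4 * γ := by
  by_contra! hlt
  set j : ℕ := ⌊f i' x / γ⌋₊ + 2 with hj
  have h0 : 0 ≤ f i' x / γ := div_nonneg (hfb i' x).1 hγ.le
  have h1 : (⌊f i' x / γ⌋₊ : ℝ) * γ ≤ f i' x := by
    rw [← le_div_iff₀ hγ]; exact Nat.floor_le h0
  have h2 : f i' x < (⌊f i' x / γ⌋₊ + 1 : ℝ) * γ := by
    rw [← div_lt_iff₀ hγ]; exact Nat.lt_floor_add_one _
  have hjc : (j : ℝ) = ⌊f i' x / γ⌋₊ + 2 := by rw [hj]; push_cast; ring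
  have h3 := (hfb i x).2
  have hjN : j < N := by
    have : (j : ℝ) * γ < N * γ := by rw [hjc]; nlinarith
    exact_mod_cast lt_of_mul_lt_mul_right this hγ.le
  refine hx j hjN ⟨⟨i, hi, ?_⟩, i', hi', ?_⟩ <;> rw [hjc] <;> nlinarith

variable [MeasurableSpace X] [Countable ι]

/-- If all members of an ultrafilter oscillate around `α` on a set of measure bounded below, then
they all oscillate around `α` almost everywhere on one set of positive measure. -/
theorem exists_ae_mem_oscillationSet {P : Measure X} [IsFiniteMeasure P]
    (hf : ∀ i, Measurable (f i)) (U : Filter ι) {δ : ENNReal} (hδ : δ ≠ 0)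
    (h : ∀ G ∈ U, δ ≤ P (oscillationSet f γ α G)) :
    ∃ B : Set X, P B ≠ 0 ∧
      ∀ G ∈ U, ∀ᵐ x ∂P, x ∈ B → x ∈ oscillationSet f γ α G := by
  set c : ENNReal := ⨅ G : U.sets, P (oscillationSet f γ α G)
  have hne : Nonempty U.sets := ⟨⟨Set.univ, U.univ_sets⟩⟩
  obtain ⟨v, -, hv, hvmem⟩ := exists_seq_tendsto_sInf
    (Set.range_nonempty fun G : U.sets => P (oscillationSet f γ α G)) (OrderBot.bddBelow _)
  choose G hG using hvmem
  set H : ℕ → Set ι := fun n => ⋂ k ∈ Finset.range (n + 1), (G k : Set ι)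
  have hHU (n : ℕ) : H n ∈ U := (biInter_finset_mem _).2 fun k _ => (G k).2
  have hHanti : Antitone H := fun m n hmn =>
    Set.biInter_subset_biInter_left fun k hk => by
      simp only [Finset.coe_range, Set.mem_Iio] at hk ⊢; omega
  have hms := measurableSet_oscillationSet (γ := γ) (α := α) hf
  have hinter (A : Set ι) (hA : A ∈ U) : c ≤ P (⋂ n, oscillationSet f γ α (A ∩ H n)) := by
    rw [Antitone.measure_iInter
      (fun m n hmn => oscillationSet_mono (Set.inter_subset_inter_right _ (hHanti hmn)))
      (fun n => (hms _).nullMeasurableSet) ⟨0, measure_ne_top _ _⟩]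
    exact le_iInf fun n => iInf_le (fun G : U.sets => P (oscillationSet f γ α G))
      ⟨_, inter_mem hA (hHU n)⟩
  set B : Set X := ⋂ n, oscillationSet f γ α (H n)
  have hBc : P B ≤ c := by
    refine ge_of_tendsto' hv fun n => ?_
    rw [← hG n]
    refine measure_mono ((Set.iInter_subset _ n).trans (oscillationSet_mono ?_))
    exact Set.biInter_subset_of_mem (by simp)
  have hcB : c ≤ P B := by simpa using hinter Set.univ univ_mem
  refine ⟨B, ?_, fun A hA => ?_⟩
  · have : δ ≤ c := le_iInf fun G => h G G.2
    exact (lt_of_lt_of_le (pos_iff_ne_zero.2 hδ) (this.trans hcB)).ne'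
  · set B' : Set X := ⋂ n, oscillationSet f γ α (A ∩ H n)
    have hsub : B' ⊆ B := Set.iInter_mono fun n => oscillationSet_mono Set.inter_subset_right
    have hae : B' =ᵐ[P] B := ae_eq_of_subset_of_measure_ge hsub (hBc.trans (hinter A hA))
      (MeasurableSet.iInter fun n => hms _).nullMeasurableSet (measure_ne_top _ _)
    filter_upwards [hae.mem_iff] with x hx hxB
    exact oscillationSet_mono Set.inter_subset_left (Set.mem_iInter.1 (hx.2 hxB) 0)

/-- A family all of whose ultrafilter-large subfamilies oscillate a.e. on a set of positive measure
contains arbitrarily long Boolean independent tuples. -/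
theorem exists_independent_of_ultrafilter {P : Measure X} (U : Ultrafilter ι) {B : Set X}
    (hB : P B ≠ 0) (h : ∀ G ∈ U, ∀ᵐ x ∂P, x ∈ B → x ∈ oscillationSet f γ α G) (n : ℕ) :
    ∃ g : Fin n → ι, ∀ σ : Fin n → Bool,
      P {x ∈ B | ∀ j, if σ j then α + γ < f (g j) x else f (g j) x < α - γ} ≠ 0 := by
  induction n with
  | zero => exact ⟨Fin.elim0, fun σ => by simpa using hB⟩
  | succ n ih =>
    obtain ⟨g, hg⟩ := ih
    have key (σ : Fin (n + 1) → Bool) :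
        ∀ᶠ i in U, P {x ∈ B | (if σ 0 then α + γ < f i x else f i x < α - γ) ∧
          ∀ j : Fin n, if σ j.succ then α + γ < f (g j) x else f (g j) x < α - γ} ≠ 0 := by
      set C : ι → Set X := fun i =>
        {x ∈ B | (if σ 0 then α + γ < f i x else f i x < α - γ) ∧
          ∀ j : Fin n, if σ j.succ then α + γ < f (g j) x else f (g j) x < α - γ}
      by_contra hcon
      set S : Set ι := {i | ¬ P (C i) ≠ 0}
      have hS : S ∈ U := Ultrafilter.eventually_not.2 hcon
      have hnull : P (⋃ i ∈ S, C i) = 0 :=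
        (measure_biUnion_null_iff S.to_countable).2 fun i hi => not_not.1 hi
      refine hg (fun j => σ j.succ)
        (measure_mono_null ?_ (measure_union_null (ae_iff.1 (h S hS)) hnull))
      rintro x ⟨hxB, hx⟩
      by_cases hosc : x ∈ oscillationSet f γ α S
      · obtain ⟨⟨i, hi, hix⟩, i', hi', hix'⟩ := hosc
        refine Or.inr (Set.mem_iUnion₂.2 ?_)
        cases hσ : σ 0 with
        | true => exact ⟨i, hi, hxB, by simpa [hσ] using hix, hx⟩
        | false => exact ⟨i', hi', hxB, by simpa [hσ] using hix', hx⟩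
      · exact Or.inl fun hcontra => hosc (hcontra hxB)
    obtain ⟨i, hi⟩ := (eventually_all.2 key).exists
    refine ⟨Fin.cons i g, fun σ => ?_⟩
    simpa only [Fin.forall_fin_succ, Fin.cons_zero, Fin.cons_succ] using hi σ

end Oscillation

/-- Dual shattering: if `2 ^ k` functions cut `X` into cells that are all nonempty, then the
family shatters a set of `k` points. -/
theorem exists_gammaShatters_of_independent {X : Type*} {F : Set (X → ℝ)} {γ α : ℝ} (hγ : 0 < γ)
    {n k : ℕ} (e : Finset (Fin k) ≃ Fin n) (g : Fin n → F)
    (hg : ∀ σ : Fin n → Bool,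
      ∃ x, ∀ j, if σ j then α + γ < (g j : X → ℝ) x else (g j : X → ℝ) x < α - γ) :
    ∃ D : Finset X, D.card = k ∧ GammaShatters F γ D := by
  classical
  choose p hp using hg
  set q : Fin k → X := fun a => p fun j => decide (a ∈ e.symm j)
  have hmem {a : Fin k} {S : Finset (Fin k)} (ha : a ∈ S) :
      α + γ < (g (e S) : X → ℝ) (q a) := by
    simpa [ha] using hp (fun j => decide (a ∈ e.symm j)) (e S)
  have hnot {a : Fin k} {S : Finset (Fin k)} (ha : a ∉ S) :
      (g (e S) : X → ℝ) (q a) < α - γ := by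
    simpa [ha] using hp (fun j => decide (a ∈ e.symm j)) (e S)
  have hinj : Function.Injective q := by
    intro a b hab
    by_contra hne
    have h1 := hmem (Finset.mem_singleton_self a)
    have h2 := hnot (a := b) (S := {a}) (by simpa using Ne.symm hne)
    rw [hab] at h1
    linarith
  refine ⟨Finset.univ.image q, by simp [Finset.card_image_of_injective _ hinj], α, ?_⟩
  intro D₀ hD₀
  refine ⟨_, (g (e {a | q a ∈ D₀})).2, fun x hx => ?_, fun x hx hxD => ?_⟩
  · obtain ⟨a, -, rfl⟩ := Finset.mem_image.1 (hD₀ hx)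
    exact hmem (by simpa using hx)
  · obtain ⟨a, -, rfl⟩ := Finset.mem_image.1 hx
    exact hnot (by simpa using hxD)

/-- A proper ideal of sets is avoided by some ultrafilter. -/
theorem exists_ultrafilter_forall_not {ι : Type*} {p : Set ι → Prop} (he : p ∅)
    (hmono : ∀ G, p G → ∀ H ⊆ G, p H) (hunion : ∀ G, p G → ∀ H, p H → p (G ∪ H))
    (huniv : ¬ p Set.univ) : ∃ U : Ultrafilter ι, ∀ G ∈ U, ¬ p G := by
  have hne : (comk p he hmono hunion).NeBot := by
    refine ⟨fun h => huniv ?_⟩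
    have : ∅ ∈ comk p he hmono hunion := h ▸ mem_bot
    rwa [mem_comk, Set.compl_empty] at this
  exact ⟨Ultrafilter.of _, fun G hG hp =>
    Ultrafilter.compl_notMem_iff.2 hG (Ultrafilter.of_le _ (compl_mem_comk.2 hp))⟩

/-- A family contained in a bracket `[l, u]` of integral less than `η` has discrepancy eventually at
most `η`. -/
theorem ae_eventually_discrepancy_le_of_bracket {Ω X ι : Type*} [MeasurableSpace Ω]
    [MeasurableSpace X] {μ : Measure Ω} [IsProbabilityMeasure μ] {T : Ω → Ω} {ξ : Ω → X}
    (hT : Ergodic T μ) (hξ : Measurable ξ) {f : ι → X → ℝ} (hfm : ∀ i, Measurable (f i))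
    {G : Set ι} {l u : X → ℝ} (hl : Measurable l) (hu : Measurable u) {K : ℝ}
    (hlK : ∀ x, |l x| ≤ K) (huK : ∀ x, |u x| ≤ K) (hlf : ∀ i ∈ G, ∀ x, l x ≤ f i x)
    (hfu : ∀ i ∈ G, ∀ x, f i x ≤ u x) {η : ℝ}
    (hη : ∫ ω, (u (ξ ω) - l (ξ ω)) ∂μ < η) :
    ∀ᵐ ω ∂μ, ∀ᶠ m : ℕ in atTop, ∀ i ∈ G,
      |(1 / (m : ℝ)) * ∑ j ∈ Finset.Icc 1 m, f i (ξ (T^[j] ω)) - ∫ x, f i (ξ x) ∂μ| ≤ η := by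
  have hint {v : X → ℝ} (hv : Measurable v) (hvK : ∀ x, |v x| ≤ K) :
      Integrable (fun ω => v (ξ ω)) μ :=
    .of_bound (hv.comp hξ).aestronglyMeasurable K (.of_forall fun ω => hvK _)
  rw [integral_sub (hint hu huK) (hint hl hlK)] at hη
  have h1 := hT.ae_eventually_sum_Icc_le hξ hu huK
    (c := ∫ ω, l (ξ ω) ∂μ + η) (by linarith)
  have h2 := hT.ae_eventually_sum_Icc_le hξ hl.neg (fun x => by simpa using hlK x)
    (c := η - ∫ ω, u (ξ ω) ∂μ) (by simp only [Pi.neg_apply, integral_neg]; linarith)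
  filter_upwards [h1, h2] with ω hω1 hω2
  filter_upwards [hω1, hω2, eventually_gt_atTop 0] with m hm1 hm2 hm0 i hi
  have hm : (0 : ℝ) < m := by exact_mod_cast hm0
  have hfK (x : X) : |f i x| ≤ K :=
    abs_le.2 ⟨(abs_le.1 (hlK x)).1.trans (hlf i hi x), (hfu i hi x).trans (abs_le.1 (huK x)).2⟩
  have hil : ∫ ω, l (ξ ω) ∂μ ≤ ∫ ω, f i (ξ ω) ∂μ :=
    integral_mono (hint hl hlK) (hint (hfm i) hfK) fun ω => hlf i hi _
  have hiu : ∫ ω, f i (ξ ω) ∂μ ≤ ∫ ω, u (ξ ω) ∂μ :=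
    integral_mono (hint (hfm i) hfK) (hint hu huK) fun ω => hfu i hi _
  have hsl : ∑ j ∈ Finset.Icc 1 m, l (ξ (T^[j] ω)) ≤ ∑ j ∈ Finset.Icc 1 m, f i (ξ (T^[j] ω)) :=
    Finset.sum_le_sum fun j _ => hlf i hi _
  have hsu : ∑ j ∈ Finset.Icc 1 m, f i (ξ (T^[j] ω)) ≤ ∑ j ∈ Finset.Icc 1 m, u (ξ (T^[j] ω)) :=
    Finset.sum_le_sum fun j _ => hfu i hi _
  simp only [Pi.neg_apply, Finset.sum_neg_distrib] at hm2
  rw [one_div_mul_eq_div, abs_le, le_sub_iff_add_le, le_div_iff₀ hm, sub_le_iff_le_add,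
    div_le_iff₀ hm]
  constructor <;> nlinarith

/-- A family which oscillates, at each of the levels `j γ`, only on a small set has discrepancy
eventually at most `10 γ`. -/
theorem ae_eventually_discrepancy_le_of_oscillationSet {Ω X ι : Type*} [MeasurableSpace Ω]
    [MeasurableSpace X] [Countable ι] {μ : Measure Ω} [IsProbabilityMeasure μ] {T : Ω → Ω}
    {ξ : Ω → X} (hT : Ergodic T μ) (hξ : Measurable ξ) {f : ι → X → ℝ}
    (hfm : ∀ i, Measurable (f i)) (hfb : ∀ i x, f i x ∈ Set.Icc (0 : ℝ) 1) {γ : ℝ} (hγ : 0 < γ)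
    {N : ℕ} (hN : 1 ≤ N * γ) {G : Set ι}
    (hG : ∀ j < N, (μ.map ξ).real (oscillationSet f γ (j * γ) G) ≤ γ / N) :
    ∀ᵐ ω ∂μ, ∀ᶠ m : ℕ in atTop, ∀ i ∈ G,
      |(1 / (m : ℝ)) * ∑ j ∈ Finset.Icc 1 m, f i (ξ (T^[j] ω)) - ∫ x, f i (ξ x) ∂μ|
        ≤ 10 * γ := by
  rcases G.eq_empty_or_nonempty with rfl | hne
  · simp
  have : Nonempty G := hne.to_subtype
  set u : X → ℝ := fun x => ⨆ i : G, f i x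
  set l : X → ℝ := fun x => ⨅ i : G, f i x
  have hba (x : X) : BddAbove (Set.range fun i : G => f i x) :=
    ⟨1, by rintro _ ⟨i, rfl⟩; exact (hfb i x).2⟩
  have hbb (x : X) : BddBelow (Set.range fun i : G => f i x) :=
    ⟨0, by rintro _ ⟨i, rfl⟩; exact (hfb i x).1⟩
  have hfu : ∀ i ∈ G, ∀ x, f i x ≤ u x := fun i hi x => le_ciSup (hba x) ⟨i, hi⟩
  have hlf : ∀ i ∈ G, ∀ x, l x ≤ f i x := fun i hi x => ciInf_le (hbb x) ⟨i, hi⟩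
  have hum : Measurable u := .iSup fun i => hfm i
  have hlm : Measurable l := .iInf fun i => hfm i
  have hu1 (x : X) : u x ≤ 1 := ciSup_le fun i => (hfb i x).2
  have hl0 (x : X) : 0 ≤ l x := le_ciInf fun i => (hfb i x).1
  obtain ⟨i₀, hi₀⟩ := hne
  have hlu (x : X) : l x ≤ u x := (hlf _ hi₀ x).trans (hfu _ hi₀ x)
  refine ae_eventually_discrepancy_le_of_bracket hT hξ hfm hlm hum (K := 1)
    (fun x => abs_le.2 ⟨by linarith [hl0 x], (hlu x).trans (hu1 x)⟩)
    (fun x => abs_le.2 ⟨by linarith [hl0 x, hlu x], hu1 x⟩) hlf hfu ?_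
  set P : Measure X := μ.map ξ
  have : IsProbabilityMeasure P := Measure.isProbabilityMeasure_map hξ.aemeasurable
  have hms (j : ℕ) : MeasurableSet (oscillationSet f γ (j * γ) G) :=
    measurableSet_oscillationSet hfm G
  have hind (j : ℕ) : Integrable
      ((oscillationSet f γ (j * γ) G).indicator fun _ => (1 : ℝ)) P :=
    (integrable_const (1 : ℝ)).indicator (hms j)
  have hpt (x : X) : u x - l x ≤ 4 * γ +
      ∑ j ∈ Finset.range N, (oscillationSet f γ (j * γ) G).indicator (fun _ => (1 : ℝ)) x := by
    have hnn : ∀ j ∈ Finset.range N,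
        0 ≤ (oscillationSet f γ (j * γ) G).indicator (fun _ => (1 : ℝ)) x :=
      fun j _ => Set.indicator_nonneg (fun _ _ => zero_le_one) x
    by_cases hx : ∃ j < N, x ∈ oscillationSet f γ (j * γ) G
    · obtain ⟨j, hj, hxj⟩ := hx
      have h1 := Finset.single_le_sum hnn (Finset.mem_range.2 hj)
      rw [Set.indicator_of_mem hxj] at h1
      linarith [hu1 x, hl0 x]
    · push Not at hx
      have h1 : u x ≤ l x + 4 * γ := by
        refine ciSup_le fun i => ?_
        rw [← sub_le_iff_le_add]
        refine le_ciInf fun i' => ?_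
        linarith [sub_le_of_notMem_oscillationSet hγ hfb hN hx i.2 i'.2]
      linarith [Finset.sum_nonneg hnn]
  have hsum : Integrable (fun x => ∑ j ∈ Finset.range N,
      (oscillationSet f γ (j * γ) G).indicator (fun _ => (1 : ℝ)) x) P :=
    integrable_finsetSum _ fun j _ => hind j
  have hN0 : (0 : ℝ) < N := by
    by_contra! h
    nlinarith
  calc ∫ ω, (u (ξ ω) - l (ξ ω)) ∂μ = ∫ x, (u x - l x) ∂P :=
        (integral_map hξ.aemeasurable (hum.sub hlm).aestronglyMeasurable).symm
    _ ≤ ∫ x, (4 * γ + ∑ j ∈ Finset.range N,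
          (oscillationSet f γ (j * γ) G).indicator (fun _ => (1 : ℝ)) x) ∂P :=
        integral_mono_of_nonneg (.of_forall fun x => sub_nonneg.2 (hlu x))
          ((integrable_const _).add hsum) (.of_forall hpt)
    _ = 4 * γ + ∑ j ∈ Finset.range N, P.real (oscillationSet f γ (j * γ) G) := by
        rw [integral_add (integrable_const _) hsum, integral_finsetSum _ fun j _ => hind j]
        simp [integral_indicator_const, hms]
    _ ≤ 4 * γ + ∑ j ∈ Finset.range N, γ / N := by
        gcongr with j hj
        exact hG j (Finset.mem_range.1 hj)
    _ = 5 * γ := by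
        rw [Finset.sum_const, Finset.card_range, nsmul_eq_mul, mul_div_cancel₀ _ hN0.ne']
        ring
    _ < 10 * γ := by linarith

theorem gap_dimension_infinite_of_discrepancy
    {X Ω : Type*} [MetricSpace X] [CompleteSpace X]
    [TopologicalSpace.SeparableSpace X] [MeasurableSpace X] [BorelSpace X]
    [MeasurableSpace Ω] (μ : Measure Ω) [IsProbabilityMeasure μ]
    (T : Ω → Ω) (ξ : Ω → X) (hT : Ergodic T μ) (hξ : Measurable ξ)
    (F : Set (X → ℝ)) (hFc : F.Countable)
    (hFm : ∀ f ∈ F, Measurable f)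
    (hFb : ∀ f ∈ F, ∀ x, f x ∈ Set.Icc (0 : ℝ) 1)
    (η : ℝ) (hη : 0 < η)
    (hΓ : ∀ᵐ ω ∂μ, η < Filter.limsup (fun m : ℕ => discrepancy μ T ξ F m ω) Filter.atTop) :
    ∀ γ : ℝ, 0 < γ → γ ≤ η / 10 → ∀ k : ℕ,
      ∃ D : Finset X, D.card = k ∧ GammaShatters F γ D := by
  intro γ hγ hγη k
  have : Countable F := hFc.to_subtype
  set f : F → X → ℝ := fun i => i
  have hfm (i : F) : Measurable (f i) := hFm i i.2
  have hfb (i : F) (x : X) : f i x ∈ Set.Icc (0 : ℝ) 1 := hFb i i.2 x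
  set P : Measure X := μ.map ξ
  have : IsProbabilityMeasure P := Measure.isProbabilityMeasure_map hξ.aemeasurable
  set Good : Set F → Prop := fun G => ∀ᵐ ω ∂μ, ∀ᶠ m : ℕ in atTop, ∀ i ∈ G,
    |(1 / (m : ℝ)) * ∑ j ∈ Finset.Icc 1 m, f i (ξ (T^[j] ω)) - ∫ x, f i (ξ x) ∂μ| ≤ η
  have hbad : ¬ Good Set.univ := by
    intro hgood
    obtain ⟨ω, h1, h2⟩ := (hgood.and hΓ).exists
    refine h2.not_ge (limsup_le_of_le ?_ ?_)
    · exact isCoboundedUnder_le_of_le atTop (x := 0)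
        fun m => Real.iSup_nonneg fun i => abs_nonneg _
    · filter_upwards [h1] with m hm
      exact Real.iSup_le (fun i => hm i trivial) hη.le
  obtain ⟨U, hU⟩ := exists_ultrafilter_forall_not (p := Good) (.of_forall fun ω => by simp)
    (fun G hG H (hHG : H ⊆ G) => hG.mono fun ω hω => hω.mono fun m hm i hi => hm i (hHG hi))
    (fun G hG H hH => by
      filter_upwards [hG, hH] with ω h1 h2
      filter_upwards [h1, h2] with m h1 h2 i hi
      exact hi.elim (h1 i) (h2 i)) hbad
  obtain ⟨N, hN⟩ := exists_nat_ge (1 / γ)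
  rw [div_le_iff₀ hγ] at hN
  have hN0 : (0 : ℝ) < N := by
    by_contra! h
    nlinarith
  obtain ⟨j, hj⟩ : ∃ j : ℕ, ∀ G ∈ U, γ / N < P.real (oscillationSet f γ (j * γ) G) := by
    by_contra! hcon
    choose A hAU hA using hcon
    refine hU (⋂ j ∈ Finset.range N, A j) ((biInter_finset_mem _).2 fun j _ => hAU j) ?_
    have := ae_eventually_discrepancy_le_of_oscillationSet hT hξ hfm hfb hγ hN
      (G := ⋂ j ∈ Finset.range N, A j) fun j hj => (measureReal_mono (oscillationSet_mono
        (Set.biInter_subset_of_mem (by simpa using hj)))).trans (hA j)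
    exact this.mono fun ω hω => hω.mono fun m hm i hi => (hm i hi).trans (by linarith)
  obtain ⟨B, hB, hBU⟩ := exists_ae_mem_oscillationSet (P := P) hfm (U : Filter F)
    (δ := ENNReal.ofReal (γ / N)) (by simpa using div_pos hγ hN0)
    fun G hG => ENNReal.ofReal_le_of_le_toReal (hj G hG).le
  obtain ⟨g, hg⟩ := exists_independent_of_ultrafilter U hB hBU
    (Fintype.card (Finset (Fin k)))
  have hcell (σ : Fin (Fintype.card (Finset (Fin k))) → Bool) :=
    nonempty_of_measure_ne_zero (hg σ)
  exact exists_gammaShatters_of_independent hγ (Fintype.equivFin _) g fun σ =>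
    (hcell σ).imp fun x hx => hx.2
end

section
/- Let 𝒳 be a complete separable metric space, F a countable family of Borel measurable functions f : 𝒳 → [0,1], and X₁, X₂, … a stationary ergodic process with values in 𝒳. Then there exists a constant Γ(F) ≥ 0 such that almost surely Γ_m(F) → Γ(F) as m → ∞. -/
open MeasureTheory Filter

/-- A subadditive sequence of functions over `T` whose increments lie in `[-1, 1]`. -/
structure IsBoundedSubadditive {Ω : Type*} (T : Ω → Ω) (g : ℕ → Ω → ℝ) : Prop where
  nonneg : ∀ n ω, 0 ≤ g n ω
  le_nat : ∀ n ω, g n ω ≤ n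
  add_le : ∀ m n ω, g (m + n) ω ≤ g m ω + g n (T^[m] ω)
  le_succ : ∀ n ω, g n (T ω) ≤ g (n + 1) ω + 1

theorem liminf_le_liminf_of_tendsto_sub {u v : ℕ → ℝ}
    (hu : IsBoundedUnder (· ≥ ·) atTop u) (hv : IsCoboundedUnder (· ≥ ·) atTop v)
    (h : Tendsto (fun n => u n - v n) atTop (nhds 0)) : liminf u atTop ≤ liminf v atTop := by
  refine le_of_forall_pos_sub_le fun ε hε => le_liminf_of_le hv ?_
  filter_upwards [eventually_lt_of_lt_liminf (sub_lt_self (liminf u atTop) (half_pos hε)) hu,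
    h.eventually_lt_const (half_pos hε)] with n h1 h2
  linarith

namespace IsBoundedSubadditive

variable {Ω : Type*} {T : Ω → Ω} {g : ℕ → Ω → ℝ}

theorem div_mem_Icc (h : IsBoundedSubadditive T g) (n : ℕ) (ω : Ω) :
    g n ω / n ∈ Set.Icc (0 : ℝ) 1 :=
  ⟨div_nonneg (h.nonneg n ω) n.cast_nonneg, div_le_one_of_le₀ (h.le_nat n ω) n.cast_nonneg⟩

theorem isBoundedUnder_ge (h : IsBoundedSubadditive T g) (ω : Ω) :
    IsBoundedUnder (· ≥ ·) atTop (fun n : ℕ => g n ω / n) :=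
  isBoundedUnder_of ⟨0, fun n => (h.div_mem_Icc n ω).1⟩

theorem isBoundedUnder_le (h : IsBoundedSubadditive T g) (ω : Ω) :
    IsBoundedUnder (· ≤ ·) atTop (fun n : ℕ => g n ω / n) :=
  isBoundedUnder_of ⟨1, fun n => (h.div_mem_Icc n ω).2⟩

theorem abs_div_succ_sub_div_le (h : IsBoundedSubadditive T g) (n : ℕ) (ω : Ω) :
    |g (n + 1) ω / (n + 1 : ℕ) - g n (T ω) / n| ≤ 2 / (n + 1) := by
  rcases Nat.eq_zero_or_pos n with rfl | hn
  · have h0 := h.nonneg 1 ω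
    have h1 := h.le_nat 1 ω
    rw [abs_le]
    norm_num at *
    constructor <;> linarith
  have hn' : (0 : ℝ) < n := by exact_mod_cast hn
  have h1 := h.add_le 1 n ω
  have h2 := h.le_nat 1 ω
  have h3 := h.le_succ n ω
  have h4 := (h.div_mem_Icc n (T ω))
  rw [add_comm 1 n] at h1
  simp only [Function.iterate_one, Nat.cast_one] at h1 h2
  set y := g n (T ω) / n with hy
  have hy' : g n (T ω) = y * n := by rw [hy, div_mul_cancel₀ _ hn'.ne']
  have hsub : g (n + 1) ω / (n + 1 : ℕ) - y = (g (n + 1) ω - g n (T ω) - y) / (n + 1) := by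
    rw [hy']
    push_cast
    field_simp
    ring
  rw [hsub, abs_div, abs_of_pos (by positivity : (0 : ℝ) < n + 1)]
  gcongr
  rw [abs_le]
  constructor <;> linarith [h4.1, h4.2]

theorem liminf_comp (h : IsBoundedSubadditive T g) (ω : Ω) :
    liminf (fun n : ℕ => g n (T ω) / n) atTop = liminf (fun n : ℕ => g n ω / n) atTop := by
  rw [← liminf_nat_add (fun n : ℕ => g n ω / n) 1]
  have hd : Tendsto (fun n : ℕ => g (n + 1) ω / (n + 1 : ℕ) - g n (T ω) / n) atTop (nhds 0) := by
    refine squeeze_zero_norm (h.abs_div_succ_sub_div_le · ω) ?_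
    simpa [div_eq_mul_inv] using (tendsto_one_div_add_atTop_nhds_zero_nat (𝕜 := ℝ)).const_mul 2
  have hle : IsBoundedUnder (· ≤ ·) atTop (fun n : ℕ => g (n + 1) ω / (n + 1 : ℕ)) :=
    isBoundedUnder_of ⟨1, fun n => (h.div_mem_Icc (n + 1) ω).2⟩
  have hge : IsBoundedUnder (· ≥ ·) atTop (fun n : ℕ => g (n + 1) ω / (n + 1 : ℕ)) :=
    isBoundedUnder_of ⟨0, fun n => (h.div_mem_Icc (n + 1) ω).1⟩
  refine le_antisymm ?_ ?_
  · refine liminf_le_liminf_of_tendsto_sub (h.isBoundedUnder_ge _) hle.isCoboundedUnder_ge ?_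
    simpa using hd.neg
  · exact liminf_le_liminf_of_tendsto_sub hge (h.isBoundedUnder_le _).isCoboundedUnder_ge hd

theorem exists_le_of_liminf_lt (h : IsBoundedSubadditive T g) {ω : Ω} {t : ℝ}
    (ht : liminf (fun n : ℕ => g n ω / n) atTop < t) : ∃ n : ℕ, 1 ≤ n ∧ g n ω ≤ t * n := by
  obtain ⟨n, hn, hn1⟩ := ((frequently_lt_of_liminf_lt
    (h.isBoundedUnder_le ω).isCoboundedUnder_ge ht).and_eventually (eventually_ge_atTop 1)).exists
  have : (0 : ℝ) < n := by exact_mod_cast hn1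
  exact ⟨n, hn1, ((div_lt_iff₀ this).1 hn).le⟩

theorem liminf_nonneg (h : IsBoundedSubadditive T g) (ω : Ω) :
    0 ≤ liminf (fun n : ℕ => g n ω / n) atTop :=
  le_liminf_of_le (h.isBoundedUnder_le ω).isCoboundedUnder_ge
    (Eventually.of_forall fun n => (h.div_mem_Icc n ω).1)

variable [MeasurableSpace Ω] {μ : Measure Ω}

theorem exists_ae_liminf_eq (h : IsBoundedSubadditive T g) (hg : ∀ n, Measurable (g n))
    (hT : Ergodic T μ) : ∃ c, ∀ᵐ ω ∂μ, liminf (fun n : ℕ => g n ω / n) atTop = c :=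
  hT.ae_eq_const_of_ae_eq_comp_ae
    (Measurable.liminf fun n => (hg n).div_const (n : ℝ)).aestronglyMeasurable
    (ae_of_all _ h.liminf_comp)

/-- Outside a set `B` of small measure, every orbit segment can be cut into blocks of bounded
length along which `g` grows at rate at most `t`. -/
theorem exists_le_add_birkhoffSum [IsFiniteMeasure μ] (h : IsBoundedSubadditive T g)
    (hg : ∀ n, Measurable (g n)) {t : ℝ} (ht : 0 ≤ t)
    (hex : ∀ᵐ ω ∂μ, ∃ n : ℕ, 1 ≤ n ∧ g n ω ≤ t * n) {ε : ℝ} (hε : 0 < ε) :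
    ∃ (B : Set Ω) (M : ℕ), MeasurableSet B ∧ μ.real B < ε ∧
      ∀ (n : ℕ) (ω : Ω), g n ω ≤ t * n + birkhoffSum T (B.indicator (1 : Ω → ℝ)) n ω + M := by
  let B : ℕ → Set Ω := fun M => ⋂ n ∈ Finset.Icc 1 M, {ω | t * n < g n ω}
  have hB : ∀ M, MeasurableSet (B M) := fun M =>
    Finset.measurableSet_biInter _ fun n _ => measurableSet_lt measurable_const (hg n)
  have hanti : Antitone B := fun M N hMN =>
    Set.biInter_subset_biInter_left fun n hn => Finset.Icc_subset_Icc_right hMN hn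
  have hzero : μ (⋂ M, B M) = 0 := by
    refine measure_mono_null (fun ω hω => ?_) hex
    rintro ⟨n, hn, hle⟩
    have h1 := Set.mem_iInter.1 hω n
    simp only [B, Set.mem_iInter, Finset.mem_Icc, Set.mem_ofPred_eq] at h1
    exact (h1 n ⟨hn, le_rfl⟩).not_ge hle
  have hlim := tendsto_measure_iInter_atTop (fun M => (hB M).nullMeasurableSet (μ := μ)) hanti
    ⟨0, measure_ne_top μ _⟩
  rw [hzero] at hlim
  have hlim' := (ENNReal.tendsto_toReal ENNReal.zero_ne_top).comp hlim
  obtain ⟨M, hM⟩ := (hlim'.eventually_lt_const (by simpa using hε)).exists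
  refine ⟨B M, M, hB M, hM, fun n => ?_⟩
  have hbirk : ∀ n ω, 0 ≤ birkhoffSum T ((B M).indicator (1 : Ω → ℝ)) n ω := fun n ω =>
    Finset.sum_nonneg fun i _ => Set.indicator_nonneg (fun _ _ => zero_le_one) _
  induction n using Nat.strong_induction_on with
  | _ n ih =>
  intro ω
  rcases le_or_gt n M with hnM | hnM
  · have h1 := h.le_nat n ω
    have h2 : (n : ℝ) ≤ M := by exact_mod_cast hnM
    have h3 := hbirk n ω
    have h4 : 0 ≤ t * n := by positivity
    linarith
  · by_cases hω : ω ∈ B M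
    · obtain ⟨k, rfl⟩ : ∃ k, n = 1 + k := ⟨n - 1, by omega⟩
      have h1 := h.add_le 1 k ω
      have h2 := h.le_nat 1 ω
      have h3 := ih k (by omega) (T^[1] ω)
      rw [birkhoffSum_add, birkhoffSum_one, Set.indicator_of_mem hω]
      push_cast at *
      simp only [Pi.one_apply]
      linarith
    · simp only [B, Set.mem_iInter, Finset.mem_Icc, Set.mem_ofPred_eq, not_forall, not_lt] at hω
      obtain ⟨j, ⟨hj1, hjM⟩, hj⟩ := hω
      obtain ⟨k, rfl⟩ : ∃ k, n = j + k := ⟨n - j, by omega⟩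
      have h1 := h.add_le j k ω
      have h2 := hbirk j ω
      have h3 := ih k (by omega) (T^[j] ω)
      rw [birkhoffSum_add]
      push_cast at *
      linarith

end IsBoundedSubadditive

section Birkhoff

variable {Ω : Type*} {T : Ω → Ω}

theorem isBoundedSubadditive_birkhoffSum_indicator (B : Set Ω) :
    IsBoundedSubadditive T (birkhoffSum T (B.indicator (1 : Ω → ℝ))) where
  nonneg n ω := Finset.sum_nonneg fun i _ => Set.indicator_nonneg (fun _ _ => zero_le_one) _
  le_nat n ω := by
    calc birkhoffSum T (B.indicator (1 : Ω → ℝ)) n ω ≤ ∑ i ∈ Finset.range n, (1 : ℝ) :=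
          Finset.sum_le_sum fun i _ => Set.indicator_le_self' (fun _ _ => zero_le_one) _
      _ = n := by simp
  add_le m n ω := (birkhoffSum_add T _ m n ω).le
  le_succ n ω := by
    rw [birkhoffSum_succ']
    have : 0 ≤ B.indicator (1 : Ω → ℝ) ω := Set.indicator_nonneg (fun _ _ => zero_le_one) _
    linarith

variable [MeasurableSpace Ω] {μ : Measure Ω}

theorem measurable_birkhoffSum (hT : Measurable T) {φ : Ω → ℝ} (hφ : Measurable φ) (n : ℕ) :
    Measurable (birkhoffSum T φ n) :=
  Finset.measurable_fun_sum _ fun i _ => hφ.comp (hT.iterate i)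

theorem integrable_birkhoffSum (hT : MeasurePreserving T μ μ) {φ : Ω → ℝ} (hφ : Integrable φ μ)
    (n : ℕ) : Integrable (birkhoffSum T φ n) μ :=
  integrable_finsetSum _ fun i _ => (hT.iterate i).integrable_comp_of_integrable hφ

theorem integral_birkhoffSum (hT : MeasurePreserving T μ μ) {φ : Ω → ℝ} (hφ : Integrable φ μ)
    (n : ℕ) : ∫ ω, birkhoffSum T φ n ω ∂μ = n * ∫ ω, φ ω ∂μ := by
  have hi : ∀ i, ∫ ω, φ (T^[i] ω) ∂μ = ∫ ω, φ ω ∂μ := fun i => by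
    have hm := hT.iterate i
    rw [← integral_map hm.aemeasurable (by rw [hm.map_eq]; exact hφ.aestronglyMeasurable),
      hm.map_eq]
  simp only [birkhoffSum]
  rw [integral_finsetSum (f := fun i ω => φ (T^[i] ω)) _
    fun i _ => (hT.iterate i).integrable_comp_of_integrable hφ]
  simp [hi]

variable [IsProbabilityMeasure μ]

theorem measureReal_le_of_ae_liminf_eq (hT : MeasurePreserving T μ μ) {C : Set Ω}
    (hC : MeasurableSet C) {c : ℝ} (hc : ∀ᵐ ω ∂μ,
      liminf (fun n : ℕ => birkhoffSum T (C.indicator (1 : Ω → ℝ)) n ω / n) atTop = c) :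
    μ.real C ≤ c := by
  have hS := isBoundedSubadditive_birkhoffSum_indicator (T := T) C
  have hint : ∀ {A : Set Ω}, MeasurableSet A → Integrable (A.indicator (1 : Ω → ℝ)) μ :=
    fun hA => (integrable_const (1 : ℝ)).indicator hA
  have hc0 : 0 ≤ c := by
    obtain ⟨ω, hω⟩ := hc.exists
    exact hω ▸ hS.liminf_nonneg ω
  refine le_of_forall_pos_le_add fun ε hε => ?_
  obtain ⟨B, M, hB, hBε, hle⟩ := hS.exists_le_add_birkhoffSum (μ := μ)
    (measurable_birkhoffSum hT.measurable (measurable_one.indicator hC))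
    (by positivity : 0 ≤ c + ε / 2)
    (hc.mono fun ω hω => hS.exists_le_of_liminf_lt (by rw [hω]; linarith)) (half_pos hε)
  have key : ∀ n : ℕ, (μ.real C - c - ε / 2 - μ.real B) * n ≤ M := fun n => by
    have hBn := integrable_birkhoffSum hT (hint hB) n
    have hsum : Integrable (fun ω => (c + ε / 2) * n +
        birkhoffSum T (B.indicator (1 : Ω → ℝ)) n ω) μ := (integrable_const _).add hBn
    have h1 := integral_mono (integrable_birkhoffSum hT (hint hC) n)
      (hsum.add (integrable_const (M : ℝ))) (hle n)
    simp only [Pi.add_apply] at h1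
    rw [integral_add hsum (integrable_const _), integral_add (integrable_const _) hBn,
      integral_birkhoffSum hT (hint hC), integral_birkhoffSum hT (hint hB),
      integral_indicator_one hC, integral_indicator_one hB, integral_const, integral_const] at h1
    simp only [probReal_univ, one_smul] at h1
    linarith
  by_contra! hlt
  have hpos : 0 < μ.real C - c - ε / 2 - μ.real B := by linarith
  obtain ⟨n, hn⟩ := exists_nat_gt (M / (μ.real C - c - ε / 2 - μ.real B))
  rw [div_lt_iff₀ hpos] at hn
  linarith [key n]

theorem ae_eventually_birkhoffSum_indicator_le (hT : Ergodic T μ) {B : Set Ω}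
    (hB : MeasurableSet B) : ∀ᵐ ω ∂μ, ∀ δ > 0, ∀ᶠ n : ℕ in atTop,
      birkhoffSum T (B.indicator (1 : Ω → ℝ)) n ω ≤ (μ.real B + δ) * n := by
  have hS := isBoundedSubadditive_birkhoffSum_indicator (T := T) Bᶜ
  obtain ⟨c, hc⟩ := hS.exists_ae_liminf_eq
    (measurable_birkhoffSum hT.measurable (measurable_one.indicator hB.compl)) hT
  have hle := measureReal_le_of_ae_liminf_eq hT.toMeasurePreserving hB.compl hc
  rw [probReal_compl_eq_one_sub hB] at hle
  filter_upwards [hc] with ω hω δ hδ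
  filter_upwards [eventually_lt_of_lt_liminf (by rw [hω]; linarith : 1 - μ.real B - δ < _)
    (hS.isBoundedUnder_ge ω), eventually_gt_atTop 0] with n hn hn0
  have hn' : (0 : ℝ) < n := by exact_mod_cast hn0
  rw [lt_div_iff₀ hn'] at hn
  have hsum : birkhoffSum T (B.indicator (1 : Ω → ℝ)) n ω
      + birkhoffSum T (Bᶜ.indicator (1 : Ω → ℝ)) n ω = n := by
    simp only [birkhoffSum, ← Finset.sum_add_distrib, Set.indicator_self_add_compl_apply]
    simp
  linarith

/-- The subadditive ergodic theorem for bounded increments and an ergodic transformation. -/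
theorem IsBoundedSubadditive.exists_ae_tendsto {g : ℕ → Ω → ℝ} (h : IsBoundedSubadditive T g)
    (hg : ∀ n, Measurable (g n)) (hT : Ergodic T μ) :
    ∃ c : ℝ, 0 ≤ c ∧ ∀ᵐ ω ∂μ, Tendsto (fun n : ℕ => g n ω / n) atTop (nhds c) := by
  obtain ⟨c, hc⟩ := h.exists_ae_liminf_eq hg hT
  have hc0 : 0 ≤ c := by
    obtain ⟨ω, hω⟩ := hc.exists
    exact hω ▸ h.liminf_nonneg ω
  have hup : ∀ ε > 0, ∀ᵐ ω ∂μ, limsup (fun n : ℕ => g n ω / n) atTop ≤ c + ε := fun ε hε => by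
    have hε4 : 0 < ε / 4 := by positivity
    obtain ⟨B, M, hB, hBε, hle⟩ := h.exists_le_add_birkhoffSum (μ := μ) hg
      (by positivity : 0 ≤ c + ε / 4)
      (hc.mono fun ω hω => h.exists_le_of_liminf_lt (by rw [hω]; linarith)) hε4
    filter_upwards [ae_eventually_birkhoffSum_indicator_le hT hB] with ω hω
    refine limsup_le_of_le (h.isBoundedUnder_ge ω).isCoboundedUnder_le ?_
    filter_upwards [hω _ hε4, eventually_gt_atTop 0, (tendsto_natCast_atTop_atTop
      (R := ℝ)).eventually_ge_atTop (M / (ε / 4))] with n h1 hn0 h2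
    have hn' : (0 : ℝ) < n := by exact_mod_cast hn0
    rw [div_le_iff₀ hε4] at h2
    rw [div_le_iff₀ hn']
    have h3 := mul_le_mul_of_nonneg_right hBε.le hn'.le
    linarith [hle n ω]
  refine ⟨c, hc0, ?_⟩
  have hall : ∀ᵐ ω ∂μ, ∀ k : ℕ,
      limsup (fun n : ℕ => g n ω / n) atTop ≤ c + 1 / ((k : ℝ) + 1) :=
    ae_all_iff.2 fun k => hup _ (by positivity)
  filter_upwards [hc, hall] with ω h1 h2
  refine tendsto_of_le_liminf_of_limsup_le h1.ge ?_ (h.isBoundedUnder_le ω) (h.isBoundedUnder_ge ω)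
  have hlim := (tendsto_one_div_add_atTop_nhds_zero_nat (𝕜 := ℝ)).const_add c
  rw [add_zero] at hlim
  exact ge_of_tendsto' hlim h2

end Birkhoff

section Discrepancy

variable {Ω X : Type*} [MeasurableSpace Ω] {μ : Measure Ω} {T : Ω → Ω} {ξ : Ω → X}
  {F : Set (X → ℝ)}

theorem natCast_mul_discrepancy (m : ℕ) (ω : Ω) : m * discrepancy μ T ξ F m ω =
    ⨆ f : F, |∑ i ∈ Finset.Icc 1 m, ((f : X → ℝ) (ξ (T^[i] ω)) - ∫ x, (f : X → ℝ) (ξ x) ∂μ)| := by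
  rw [discrepancy, Real.mul_iSup_of_nonneg m.cast_nonneg]
  congr 1 with f
  rcases Nat.eq_zero_or_pos m with rfl | hm
  · simp
  have hm' : (m : ℝ) ≠ 0 := by positivity
  nth_rewrite 1 [← abs_of_nonneg (Nat.cast_nonneg (α := ℝ) m)]
  rw [← abs_mul, mul_sub, ← mul_assoc, mul_one_div_cancel hm', one_mul]
  simp

theorem measurable_discrepancy [MeasurableSpace X] (hFc : F.Countable)
    (hFm : ∀ f ∈ F, Measurable f) (hT : Measurable T) (hξ : Measurable ξ) (m : ℕ) :
    Measurable (discrepancy μ T ξ F m) := by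
  have := hFc.to_subtype
  refine Measurable.iSup fun f => Measurable.abs (Measurable.sub_const (Measurable.const_mul ?_ _) _)
  exact Finset.measurable_fun_sum _ fun i _ => ((hFm f f.2).comp hξ).comp (hT.iterate i)

variable [IsProbabilityMeasure μ]

theorem abs_sub_integral_le_one
    (hFb : ∀ f ∈ F, ∀ x, f x ∈ Set.Icc (0 : ℝ) 1) {f : X → ℝ} (hf : f ∈ F) (x : X) :
    |f x - ∫ ω, f (ξ ω) ∂μ| ≤ 1 := by
  have h0 : 0 ≤ ∫ ω, f (ξ ω) ∂μ := integral_nonneg fun ω => (hFb f hf _).1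
  have h1 : ∫ ω, f (ξ ω) ∂μ ≤ 1 := by
    have := norm_integral_le_of_norm_le_const (μ := μ) (f := fun ω => f (ξ ω)) (C := 1)
      (ae_of_all _ fun ω => by
        rw [Real.norm_eq_abs, abs_of_nonneg (hFb f hf _).1]
        exact (hFb f hf _).2)
    simpa using (le_abs_self _).trans this
  rw [abs_le]
  constructor <;> linarith [(hFb f hf x).1, (hFb f hf x).2]

theorem abs_sum_sub_integral_le
    (hFb : ∀ f ∈ F, ∀ x, f x ∈ Set.Icc (0 : ℝ) 1) {f : X → ℝ} (hf : f ∈ F) (m : ℕ) (ω : Ω) :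
    |∑ i ∈ Finset.Icc 1 m, (f (ξ (T^[i] ω)) - ∫ x, f (ξ x) ∂μ)| ≤ m := by
  refine (Finset.abs_sum_le_sum_abs _ _).trans ?_
  refine (Finset.sum_le_sum fun i _ => abs_sub_integral_le_one hFb hf _).trans ?_
  simp

theorem abs_sum_sub_integral_le_natCast_mul_discrepancy
    (hFb : ∀ f ∈ F, ∀ x, f x ∈ Set.Icc (0 : ℝ) 1) {f : X → ℝ} (hf : f ∈ F) (m : ℕ) (ω : Ω) :
    |∑ i ∈ Finset.Icc 1 m, (f (ξ (T^[i] ω)) - ∫ x, f (ξ x) ∂μ)| ≤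
      m * discrepancy μ T ξ F m ω := by
  rw [natCast_mul_discrepancy]
  refine le_ciSup (f := fun f : F => |∑ i ∈ Finset.Icc 1 m,
    ((f : X → ℝ) (ξ (T^[i] ω)) - ∫ x, (f : X → ℝ) (ξ x) ∂μ)|) ⟨m, ?_⟩ ⟨f, hf⟩
  rintro _ ⟨f, rfl⟩
  exact abs_sum_sub_integral_le hFb f.2 m ω

theorem isBoundedSubadditive_natCast_mul_discrepancy
    (hFb : ∀ f ∈ F, ∀ x, f x ∈ Set.Icc (0 : ℝ) 1) :
    IsBoundedSubadditive T (fun m ω => m * discrepancy μ T ξ F m ω) := by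
  have hnonneg : ∀ (n : ℕ) (ω : Ω), 0 ≤ n * discrepancy μ T ξ F n ω := fun n ω =>
    mul_nonneg n.cast_nonneg (Real.iSup_nonneg fun _ => abs_nonneg _)
  have hsplit : ∀ (f : X → ℝ) (m n : ℕ) (ω : Ω),
      ∑ i ∈ Finset.Icc 1 (m + n), (f (ξ (T^[i] ω)) - ∫ x, f (ξ x) ∂μ) =
        ∑ i ∈ Finset.Icc 1 m, (f (ξ (T^[i] ω)) - ∫ x, f (ξ x) ∂μ) +
        ∑ i ∈ Finset.Icc 1 n, (f (ξ (T^[i] (T^[m] ω))) - ∫ x, f (ξ x) ∂μ) := by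
    intro f m n ω
    induction n with
    | zero => simp
    | succ n ih =>
      rw [← add_assoc, Finset.sum_Icc_succ_top (by omega), Finset.sum_Icc_succ_top (by omega), ih,
        ← Function.iterate_add_apply, add_assoc, show n + 1 + m = m + n + 1 by omega]
  refine ⟨hnonneg, fun n ω => ?_, fun m n ω => ?_, fun n ω => ?_⟩
  · rw [natCast_mul_discrepancy]
    exact Real.iSup_le (fun f => abs_sum_sub_integral_le hFb f.2 n ω) n.cast_nonneg
  · rw [natCast_mul_discrepancy]
    refine Real.iSup_le (fun f => ?_) (add_nonneg (hnonneg m ω) (hnonneg n _))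
    rw [hsplit]
    exact (abs_add_le _ _).trans (add_le_add
      (abs_sum_sub_integral_le_natCast_mul_discrepancy hFb f.2 m ω)
      (abs_sum_sub_integral_le_natCast_mul_discrepancy hFb f.2 n _))
  · rw [natCast_mul_discrepancy n]
    refine Real.iSup_le (fun f => ?_) (add_nonneg (hnonneg (n + 1) ω) zero_le_one)
    have h1 := abs_sum_sub_integral_le_natCast_mul_discrepancy (μ := μ) (T := T) (ξ := ξ) hFb f.2
      (1 + n) ω
    have h2 := abs_sum_sub_integral_le (μ := μ) (T := T) (ξ := ξ) hFb f.2 1 ω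
    rw [add_comm n 1]
    rw [hsplit] at h1
    have h3 := abs_sub_abs_le_abs_sub
      (∑ i ∈ Finset.Icc 1 n, ((f : X → ℝ) (ξ (T^[i] (T^[1] ω))) - ∫ x, (f : X → ℝ) (ξ x) ∂μ))
      (-∑ i ∈ Finset.Icc 1 1, ((f : X → ℝ) (ξ (T^[i] ω)) - ∫ x, (f : X → ℝ) (ξ x) ∂μ))
    rw [sub_neg_eq_add, abs_neg, add_comm (∑ i ∈ Finset.Icc 1 n, _)] at h3
    rw [Nat.cast_one] at h2
    simp only [Function.iterate_one] at h1 h3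
    linarith

end Discrepancy

theorem discrepancy_tendsto_const
    {X Ω : Type*} [MetricSpace X] [CompleteSpace X]
    [TopologicalSpace.SeparableSpace X] [MeasurableSpace X] [BorelSpace X]
    (F : Set (X → ℝ)) (hFc : F.Countable)
    (hFm : ∀ f ∈ F, Measurable f)
    (hFb : ∀ f ∈ F, ∀ x, f x ∈ Set.Icc (0 : ℝ) 1)
    [MeasurableSpace Ω] (μ : Measure Ω) [IsProbabilityMeasure μ]
    (T : Ω → Ω) (ξ : Ω → X) (hT : Ergodic T μ) (hξ : Measurable ξ) :
    ∃ Γ : ℝ, 0 ≤ Γ ∧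
      ∀ᵐ ω ∂μ, Filter.Tendsto (fun m : ℕ => discrepancy μ T ξ F m ω) Filter.atTop (nhds Γ) := by
  obtain ⟨Γ, hΓ, hlim⟩ := (isBoundedSubadditive_natCast_mul_discrepancy (μ := μ) (T := T) (ξ := ξ)
    hFb).exists_ae_tendsto
    (fun m => (measurable_discrepancy hFc hFm hT.measurable hξ m).const_mul (m : ℝ)) hT
  refine ⟨Γ, hΓ, hlim.mono fun ω hω => hω.congr' ?_⟩
  filter_upwards [eventually_ne_atTop 0] with m hm
  exact mul_div_cancel_left₀ _ (Nat.cast_ne_zero.2 hm)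
end

section
/- Let F be a countable family of Borel measurable functions f : [0,1] → [0,1], and let X₁, X₂, … be a stationary ergodic process with values in [0,1] whose marginal distribution is Lebesgue measure (i.e., the law of each Xᵢ is Lebesgue measure on [0,1]). If there exists η > 0 such that almost surely limsup_{m→∞} Γ_m(F) > η, then for every γ with 0 < γ ≤ η/10 and every k ∈ ℕ, the family F γ-shatters some finite subset of [0,1] of cardinality k. -/
open MeasureTheory Filter unitInterval

open Topology

section Ergodic

variable {Ω : Type*}

/-- The running maximum of the Birkhoff sums of `h` (including the empty sum), defined through
its recursion along the map `T`. -/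
noncomputable def maxBirkhoffSum (T : Ω → Ω) (h : Ω → ℝ) : ℕ → Ω → ℝ
  | 0 => fun _ => 0
  | n + 1 => fun ω => max 0 (h ω + maxBirkhoffSum T h n (T ω))

variable {T : Ω → Ω} {h : Ω → ℝ}

theorem maxBirkhoffSum_nonneg (n : ℕ) (ω : Ω) : 0 ≤ maxBirkhoffSum T h n ω := by
  cases n <;> simp [maxBirkhoffSum]

theorem maxBirkhoffSum_le_succ (n : ℕ) (ω : Ω) :
    maxBirkhoffSum T h n ω ≤ maxBirkhoffSum T h (n + 1) ω := by
  induction n generalizing ω with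
  | zero => exact maxBirkhoffSum_nonneg 1 ω
  | succ n ih => exact max_le_max le_rfl (add_le_add le_rfl (ih (T ω)))

theorem monotone_maxBirkhoffSum (ω : Ω) : Monotone fun n => maxBirkhoffSum T h n ω :=
  monotone_nat_of_le_succ fun n => maxBirkhoffSum_le_succ n ω

theorem birkhoffSum_le_maxBirkhoffSum (n : ℕ) (ω : Ω) :
    birkhoffSum T h n ω ≤ maxBirkhoffSum T h n ω := by
  induction n generalizing ω with
  | zero => simp [maxBirkhoffSum]
  | succ n ih =>
    rw [birkhoffSum_succ']
    exact (add_le_add le_rfl (ih (T ω))).trans (le_max_right _ _)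

theorem maxBirkhoffSum_le {C : ℝ} (hC : ∀ ω, |h ω| ≤ C) (n : ℕ) (ω : Ω) :
    maxBirkhoffSum T h n ω ≤ n * C := by
  induction n generalizing ω with
  | zero => simp [maxBirkhoffSum]
  | succ n ih =>
    have h0 : 0 ≤ C := (abs_nonneg _).trans (hC ω)
    refine max_le (by positivity) ?_
    push_cast
    linarith [ih (T ω), le_abs_self (h ω), hC ω]

theorem bddAbove_maxBirkhoffSum_comp_iff (ω : Ω) :
    BddAbove (Set.range fun n => maxBirkhoffSum T h n (T ω)) ↔
      BddAbove (Set.range fun n => maxBirkhoffSum T h n ω) := by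
  constructor
  · rintro ⟨b, hb⟩
    refine ⟨max 0 (h ω + b), ?_⟩
    rintro _ ⟨n, rfl⟩
    refine (maxBirkhoffSum_le_succ n ω).trans ?_
    exact max_le_max le_rfl (add_le_add le_rfl (hb ⟨n, rfl⟩))
  · rintro ⟨b, hb⟩
    refine ⟨b - h ω, ?_⟩
    rintro _ ⟨n, rfl⟩
    have h1 : maxBirkhoffSum T h (n + 1) ω ≤ b := hb ⟨n + 1, rfl⟩
    have h2 : h ω + maxBirkhoffSum T h n (T ω) ≤ maxBirkhoffSum T h (n + 1) ω := le_max_right _ _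
    change maxBirkhoffSum T h n (T ω) ≤ b - h ω
    linarith

theorem abs_maxBirkhoffSum_succ_sub_comp_le {C : ℝ} (hC : ∀ ω, |h ω| ≤ C) (n : ℕ) (ω : Ω) :
    |maxBirkhoffSum T h (n + 1) ω - maxBirkhoffSum T h n (T ω)| ≤ C := by
  have h1 := abs_le.1 (hC ω)
  have h2 : 0 ≤ maxBirkhoffSum T h n (T ω) := maxBirkhoffSum_nonneg n (T ω)
  change |max 0 (h ω + maxBirkhoffSum T h n (T ω)) - maxBirkhoffSum T h n (T ω)| ≤ C
  rw [abs_le]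
  rcases max_cases 0 (h ω + maxBirkhoffSum T h n (T ω)) with h | h <;>
    constructor <;> linarith

variable [MeasurableSpace Ω] {μ : Measure Ω}

theorem measurable_maxBirkhoffSum (hT : Measurable T) (hh : Measurable h) (n : ℕ) :
    Measurable (maxBirkhoffSum T h n) := by
  induction n with
  | zero => exact measurable_const
  | succ n ih => exact measurable_const.max (hh.add (ih.comp hT))

/-- The Birkhoff sums of a bounded function with negative integral are almost surely bounded
above. -/
theorem ae_bddAbove_birkhoffSum [IsProbabilityMeasure μ] (hT : Ergodic T μ) (hh : Measurable h)
    {C : ℝ} (hC : ∀ ω, |h ω| ≤ C) (hneg : ∫ ω, h ω ∂μ < 0) :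
    ∀ᵐ ω ∂μ, BddAbove (Set.range fun n => birkhoffSum T h n ω) := by
  have hmeas := measurable_maxBirkhoffSum hT.measurable hh
  have hint (n : ℕ) : Integrable (maxBirkhoffSum T h n) μ := by
    refine .of_bound (hmeas n).aestronglyMeasurable (n * C) (.of_forall fun ω => ?_)
    rw [Real.norm_eq_abs, abs_of_nonneg (maxBirkhoffSum_nonneg n ω)]
    exact maxBirkhoffSum_le hC n ω
  have hE : MeasurableSet {ω | BddAbove (Set.range fun n => maxBirkhoffSum T h n ω)} :=
    measurableSet_bddAbove_range hmeas
  rcases hT.toPreErgodic.ae_mem_or_ae_notMem hE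
    (Set.ext fun ω => bddAbove_maxBirkhoffSum_comp_iff ω) with hb | hb
  · filter_upwards [hb] with ω hω
    obtain ⟨b, hb⟩ := hω
    refine ⟨b, ?_⟩
    rintro _ ⟨n, rfl⟩
    exact (birkhoffSum_le_maxBirkhoffSum n ω).trans (hb ⟨n, rfl⟩)
  · exfalso
    have hlim : Tendsto (fun n => ∫ ω, (maxBirkhoffSum T h (n + 1) ω -
        maxBirkhoffSum T h n (T ω)) ∂μ) atTop (𝓝 (∫ ω, h ω ∂μ)) := by
      refine tendsto_integral_of_dominated_convergence (fun _ => C) (fun n => ?_)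
        (integrable_const C) (fun n => .of_forall fun ω =>
          abs_maxBirkhoffSum_succ_sub_comp_le hC n ω) ?_
      · exact ((hmeas (n + 1)).sub ((hmeas n).comp hT.measurable)).aestronglyMeasurable
      · filter_upwards [hb] with ω hω
        have hω' : ¬ BddAbove (Set.range fun n => maxBirkhoffSum T h n (T ω)) :=
          fun hbd => hω ((bddAbove_maxBirkhoffSum_comp_iff ω).1 hbd)
        have htop := tendsto_atTop_atTop_of_monotone' (monotone_maxBirkhoffSum (T ω)) hω'
        refine tendsto_const_nhds.congr' ?_
        filter_upwards [htop.eventually_ge_atTop (-h ω)] with n hn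
        change h ω = max 0 (h ω + maxBirkhoffSum T h n (T ω)) - maxBirkhoffSum T h n (T ω)
        rw [max_eq_right (by linarith)]
        ring
    refine absurd (ge_of_tendsto' hlim fun n => ?_) (not_le.2 hneg)
    have hcomp : ∫ ω, maxBirkhoffSum T h n (T ω) ∂μ = ∫ ω, maxBirkhoffSum T h n ω ∂μ := by
      conv_rhs => rw [← hT.map_eq]
      exact (integral_map hT.measurable.aemeasurable (hmeas n).aestronglyMeasurable).symm
    have hintT : Integrable (fun ω => maxBirkhoffSum T h n (T ω)) μ :=
      hT.toMeasurePreserving.integrable_comp_of_integrable (hint n)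
    rw [integral_sub (hint _) hintT, hcomp, sub_nonneg]
    exact integral_mono (hint n) (hint _) fun ω => maxBirkhoffSum_le_succ n ω

/-- The upper half of the pointwise ergodic theorem for bounded functions. -/
theorem ae_eventually_birkhoffAverage_le [IsProbabilityMeasure μ] (hT : Ergodic T μ)
    {g : Ω → ℝ} (hg : Measurable g) {C : ℝ} (hC : ∀ ω, |g ω| ≤ C) {ε : ℝ} (hε : 0 < ε) :
    ∀ᵐ ω ∂μ, ∀ᶠ m : ℕ in atTop,
      1 / (m : ℝ) * ∑ i ∈ Finset.Icc 1 m, g (T^[i] ω) ≤ ∫ ω, g ω ∂μ + ε := by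
  set c : ℝ := ∫ ω, g ω ∂μ + ε / 2 with hc
  have hgi : Integrable g μ := .of_bound hg.aestronglyMeasurable C (.of_forall hC)
  have hbdd := ae_bddAbove_birkhoffSum (h := fun ω => g ω - c) hT (hg.sub_const c)
    (C := C + |c|) (fun ω => (abs_sub _ _).trans (add_le_add (hC ω) le_rfl)) (by
      rw [integral_sub hgi (integrable_const c)]
      simp [hc, hε])
  filter_upwards [hT.quasiMeasurePreserving.ae hbdd] with ω ⟨b, hb⟩
  have hlim : Tendsto (fun m : ℕ => b / m) atTop (𝓝 0) := tendsto_const_div_atTop_nhds_zero_nat b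
  filter_upwards [eventually_gt_atTop 0, hlim.eventually_le_const (half_pos hε)] with m hm hbm
  have hm' : (0 : ℝ) < m := Nat.cast_pos.2 hm
  have hsum : birkhoffSum T (fun ω => g ω - c) m (T ω) =
      ∑ i ∈ Finset.Icc 1 m, g (T^[i] ω) - m * c := by
    rw [← Finset.Ico_add_one_right_eq_Icc, Finset.sum_Ico_eq_sum_range]
    simp [birkhoffSum, Finset.sum_sub_distrib, add_comm 1, Function.iterate_succ_apply]
  have hle : birkhoffSum T (fun ω => g ω - c) m (T ω) ≤ b := hb ⟨m, rfl⟩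
  rw [hsum] at hle
  rw [one_div, inv_mul_le_iff₀ hm']
  rw [div_le_iff₀ hm'] at hbm
  nlinarith

end Ergodic

section Brackets

variable {X : Type*} [MeasurableSpace X]

/-- The functions lying almost everywhere between `p.1` and `p.2`. -/
def aeBracket (P : Measure X) (p : (X → ℝ) × (X → ℝ)) : Set (X → ℝ) :=
  {f | p.1 ≤ᵐ[P] f ∧ f ≤ᵐ[P] p.2}

/-- Pairs of measurable functions with values in `[-1, 1]` whose difference has integral at
most `η`. -/
def smallBrackets (P : Measure X) (η : ℝ) : Set ((X → ℝ) × (X → ℝ)) :=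
  {p | Measurable p.1 ∧ Measurable p.2 ∧ (∀ x, |p.1 x| ≤ 1) ∧ (∀ x, |p.2 x| ≤ 1) ∧
    ∫ x, (p.2 x - p.1 x) ∂P ≤ η}

theorem integrable_of_abs_le_one {P : Measure X} [IsProbabilityMeasure P] {f : X → ℝ}
    (hf : Measurable f) (hb : ∀ x, |f x| ≤ 1) : Integrable f P :=
  .of_bound hf.aestronglyMeasurable 1 (.of_forall hb)

/-- A family with finitely many brackets of size `η` has asymptotic discrepancy at most `η`. -/
theorem ae_limsup_discrepancy_le {Ω : Type*} [MeasurableSpace Ω] {μ : Measure Ω}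
    [IsProbabilityMeasure μ] {T : Ω → Ω} {ξ : Ω → X} (hT : Ergodic T μ) (hξ : Measurable ξ)
    {F : Set (X → ℝ)} (hFc : F.Countable) (hFm : ∀ f ∈ F, Measurable f)
    (hFb : ∀ f ∈ F, ∀ x, |f x| ≤ 1) {η : ℝ} (hη : 0 ≤ η)
    {B : Set ((X → ℝ) × (X → ℝ))} (hB : B.Finite) (hBη : B ⊆ smallBrackets (μ.map ξ) η)
    (hcover : F ⊆ ⋃ p ∈ B, aeBracket (μ.map ξ) p) :
    ∀ᵐ ω ∂μ, limsup (fun m : ℕ => discrepancy μ T ξ F m ω) atTop ≤ η := by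
  have : IsProbabilityMeasure (μ.map ξ) := Measure.isProbabilityMeasure_map hξ.aemeasurable
  have hξm (g : X → ℝ) (hg : Measurable g) : ∫ x, g x ∂(μ.map ξ) = ∫ ω, g (ξ ω) ∂μ :=
    integral_map hξ.aemeasurable hg.aestronglyMeasurable
  have hiter {p : X → Prop} (hp : ∀ᵐ x ∂(μ.map ξ), p x) : ∀ᵐ ω ∂μ, ∀ i, p (ξ (T^[i] ω)) :=
    ae_all_iff.2 fun i =>
      (hT.toMeasurePreserving.iterate i).quasiMeasurePreserving.ae
        (ae_of_ae_map hξ.aemeasurable hp)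
  choose! q hqB hq using fun f (hf : f ∈ F) => Set.mem_iUnion₂.1 (hcover hf)
  have hsandwich : ∀ᵐ ω ∂μ, ∀ f ∈ F, ∀ i, (q f).1 (ξ (T^[i] ω)) ≤ f (ξ (T^[i] ω)) ∧
      f (ξ (T^[i] ω)) ≤ (q f).2 (ξ (T^[i] ω)) :=
    (ae_ball_iff hFc).2 fun f hf => hiter ((hq f hf).1.and (hq f hf).2)
  have haverage : ∀ᵐ ω ∂μ, ∀ n : ℕ, ∀ p ∈ B, ∀ᶠ m : ℕ in atTop,
      1 / (m : ℝ) * ∑ i ∈ Finset.Icc 1 m, p.2 (ξ (T^[i] ω)) ≤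
        ∫ x, p.2 x ∂(μ.map ξ) + 1 / (n + 1) ∧
      1 / (m : ℝ) * ∑ i ∈ Finset.Icc 1 m, -p.1 (ξ (T^[i] ω)) ≤
        -∫ x, p.1 x ∂(μ.map ξ) + 1 / (n + 1) := by
    refine ae_all_iff.2 fun n => (ae_ball_iff hB.countable).2 fun p hp => ?_
    obtain ⟨hm1, hm2, hb1, hb2, -⟩ := hBη hp
    have hn : (0 : ℝ) < 1 / (n + 1) := Nat.one_div_pos_of_nat
    filter_upwards [ae_eventually_birkhoffAverage_le hT (hm2.comp hξ) (fun ω => hb2 _) hn,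
      ae_eventually_birkhoffAverage_le hT (hm1.comp hξ).neg
        (fun ω => by simpa using hb1 (ξ ω)) hn] with ω h2 h1
    rw [hξm _ hm1, hξm _ hm2, ← integral_neg]
    exact h2.and h1
  filter_upwards [hsandwich, haverage] with ω hs ha
  refine le_of_forall_pos_le_add fun ε hε => ?_
  obtain ⟨n, hn⟩ := exists_nat_one_div_lt hε
  refine limsup_le_of_le ⟨0, ?_⟩ ?_
  · intro a hev
    obtain ⟨m, hm⟩ := (eventually_map.1 hev).exists
    exact (Real.iSup_nonneg fun _ => abs_nonneg _).trans hm
  filter_upwards [(Set.Finite.eventually_all hB).2 (ha n)] with m hm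
  refine Real.iSup_le (fun ⟨f, hf⟩ => ?_) (by positivity)
  obtain ⟨hm1, hm2, hb1, hb2, hsmall⟩ := hBη (hqB f hf)
  obtain ⟨hup, hlow⟩ := hm _ (hqB f hf)
  have hi1 := integrable_of_abs_le_one (P := μ.map ξ) hm1 hb1
  have hi2 := integrable_of_abs_le_one (P := μ.map ξ) hm2 hb2
  have hif := integrable_of_abs_le_one (P := μ.map ξ) (hFm f hf) (hFb f hf)
  have hI1 := integral_mono_ae hi1 hif (hq f hf).1
  have hI2 := integral_mono_ae hif hi2 (hq f hf).2
  rw [integral_sub hi2 hi1] at hsmall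
  have hm0 : (0 : ℝ) ≤ 1 / m := by positivity
  have hA1 := mul_le_mul_of_nonneg_left
    (Finset.sum_le_sum fun i (_ : i ∈ Finset.Icc 1 m) => (hs f hf i).1) hm0
  have hA2 := mul_le_mul_of_nonneg_left
    (Finset.sum_le_sum fun i (_ : i ∈ Finset.Icc 1 m) => (hs f hf i).2) hm0
  rw [Finset.sum_neg_distrib, mul_neg] at hlow
  rw [hξm f (hFm f hf)] at hI1 hI2
  change |_ - ∫ x, f (ξ x) ∂μ| ≤ _
  rw [abs_le]
  constructor <;> linarith

/-- If `F` is not covered by finitely many members of a family `𝒮` of sets, some ultrafilter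
contains `F` and no member of `𝒮`. -/
theorem exists_ultrafilter_forall_notMem {ι α : Type*} (F : Set α) (J : Set ι) (S : ι → Set α)
    (h : ∀ B ⊆ J, B.Finite → ¬ F ⊆ ⋃ p ∈ B, S p) :
    ∃ 𝒰 : Ultrafilter α, F ∈ 𝒰 ∧ ∀ p ∈ J, S p ∉ 𝒰 := by
  let G : Filter α := comk (fun t => ∃ B ⊆ J, B.Finite ∧ F ∩ t ⊆ ⋃ p ∈ B, S p)
    ⟨∅, Set.empty_subset _, Set.finite_empty, by simp⟩
    (fun t ⟨B, hB, hf, ht⟩ s hst => ⟨B, hB, hf, (Set.inter_subset_inter_right F hst).trans ht⟩)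
    (fun s ⟨B, hB, hf, hs⟩ t ⟨B', hB', hf', ht⟩ => ⟨B ∪ B', Set.union_subset hB hB', hf.union hf', by
      rw [Set.inter_union_distrib_left, Set.biUnion_union]
      exact Set.union_subset_union hs ht⟩)
  have hG : G.NeBot := by
    refine ⟨fun hbot => ?_⟩
    obtain ⟨B, hB, hf, hs⟩ : ∅ ∈ G := hbot ▸ mem_bot
    exact h B hB hf (by simpa using hs)
  refine ⟨Ultrafilter.of G, Ultrafilter.of_le G ?_, fun p hp hmem => ?_⟩
  · exact ⟨∅, Set.empty_subset _, Set.finite_empty, by simp⟩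
  · refine Ultrafilter.compl_notMem_iff.2 hmem (Ultrafilter.of_le G ?_)
    refine ⟨{p}, Set.singleton_subset_iff.2 hp, Set.finite_singleton p, ?_⟩
    simp

/-- A sup-closed family of functions with values in `[-1, 1]` has an essential supremum which is
the limit of a sequence from the family. -/
theorem exists_tendsto_essSup (P : Measure X) [IsProbabilityMeasure P] {L : Set (X → ℝ)}
    (hne : L.Nonempty) (hsup : ∀ a ∈ L, ∀ b ∈ L, a ⊔ b ∈ L) (hm : ∀ a ∈ L, Measurable a)
    (hb : ∀ a ∈ L, ∀ x, |a x| ≤ 1) :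
    ∃ (l : ℕ → X → ℝ) (g : X → ℝ), (∀ n, l n ∈ L) ∧
      (∀ x, Tendsto (fun n => l n x) atTop (𝓝 (g x))) ∧ ∀ a ∈ L, a ≤ᵐ[P] g := by
  have hi (a) (ha : a ∈ L) : Integrable a P := integrable_of_abs_le_one (hm a ha) (hb a ha)
  set J : Set ℝ := (fun a : X → ℝ => ∫ x, a x ∂P) '' L
  have hJb : BddAbove J := by
    refine ⟨1, ?_⟩
    rintro _ ⟨a, ha, rfl⟩
    simpa using integral_mono (hi a ha) (integrable_const (μ := P) (1 : ℝ))
      fun x => (le_abs_self _).trans (hb a ha x)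
  have hexists (n : ℕ) : ∃ a ∈ L, sSup J - 1 / (n + 1) < ∫ x, a x ∂P := by
    have hn : (0 : ℝ) < 1 / (n + 1) := Nat.one_div_pos_of_nat
    obtain ⟨_, ⟨a, ha, rfl⟩, h⟩ := exists_lt_of_lt_csSup (hne.image _) (sub_lt_self (sSup J) hn)
    exact ⟨a, ha, h⟩
  choose a haL ha using hexists
  have hlL (n : ℕ) : partialSups a n ∈ L := by
    induction n with
    | zero => simpa using haL 0
    | succ n ih => rw [partialSups_add_one]; exact hsup _ ih _ (haL _)
  have hbdd (x : X) : BddAbove (Set.range fun n => partialSups a n x) := by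
    refine ⟨1, ?_⟩
    rintro _ ⟨n, rfl⟩
    exact (le_abs_self _).trans (hb _ (hlL n) x)
  have hmono (x : X) : Monotone fun n => partialSups a n x :=
    fun i j hij => (partialSups a).monotone hij x
  have hlim (x : X) := tendsto_atTop_ciSup (hmono x) (hbdd x)
  refine ⟨fun n => partialSups a n, fun x => ⨆ n, partialSups a n x, hlL, hlim, fun b hbL => ?_⟩
  have hgm : Measurable fun x => ⨆ n, partialSups a n x :=
    measurable_of_tendsto_metrizable (fun n => hm _ (hlL n)) (tendsto_pi_nhds.2 hlim)
  have hgb (x : X) : |⨆ n, partialSups a n x| ≤ 1 :=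
    le_of_tendsto' (hlim x).abs fun n => hb _ (hlL n) x
  have hgi := integrable_of_abs_le_one (P := P) hgm hgb
  have hsupi : Integrable (fun x => max (b x) (⨆ n, partialSups a n x)) P := (hi b hbL).sup hgi
  have hexcess (n : ℕ) :
      ∫ x, max (b x) (⨆ n, partialSups a n x) ∂P - ∫ x, (⨆ n, partialSups a n x) ∂P
        ≤ 1 / (n + 1) := by
    have h1 : ∫ x, (b ⊔ partialSups a n) x ∂P ≤ sSup J :=
      le_csSup hJb ⟨_, hsup _ hbL _ (hlL n), rfl⟩
    have h2 : ∫ x, a n x ∂P ≤ ∫ x, partialSups a n x ∂P :=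
      integral_mono (hi _ (haL n)) (hi _ (hlL n)) (le_partialSups a n)
    have hli := hi _ (hlL n)
    have hbi := hi b hbL
    have h3 : ∫ x, (max (b x) (⨆ n, partialSups a n x) + partialSups a n x) ∂P ≤
        ∫ x, ((b ⊔ partialSups a n) x + ⨆ n, partialSups a n x) ∂P := by
      refine integral_mono (hsupi.add hli) ((hbi.sup hli).add hgi) fun x => ?_
      have hle : partialSups a n x ≤ ⨆ n, partialSups a n x := le_ciSup (hbdd x) n
      change max (b x) (⨆ n, partialSups a n x) + partialSups a n x ≤
        max (b x) (partialSups a n x) + ⨆ n, partialSups a n x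
      rcases max_cases (b x) (⨆ n, partialSups a n x) with h | h <;>
        linarith [le_max_left (b x) (partialSups a n x), le_max_right (b x) (partialSups a n x)]
    rw [integral_add hsupi hli, integral_add (hbi.sup hli) hgi] at h3
    have h4 := ha n
    linarith
  have hzero : ∫ x, (max (b x) (⨆ n, partialSups a n x) - ⨆ n, partialSups a n x) ∂P ≤ 0 := by
    rw [integral_sub hsupi hgi]
    exact ge_of_tendsto' tendsto_one_div_add_atTop_nhds_zero_nat hexcess
  have hnonneg : 0 ≤ fun x => max (b x) (⨆ n, partialSups a n x) - ⨆ n, partialSups a n x :=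
    fun x => sub_nonneg.2 (le_max_right _ _)
  have hae := (integral_eq_zero_iff_of_nonneg hnonneg (hsupi.sub hgi)).1
    (hzero.antisymm (integral_nonneg hnonneg))
  filter_upwards [hae] with x hx
  have hx' : max (b x) (⨆ n, partialSups a n x) - ⨆ n, partialSups a n x = 0 := hx
  linarith [le_max_left (b x) (⨆ n, partialSups a n x)]

end Brackets

section Critical

variable {X : Type*} [MeasurableSpace X]

/-- A measurable minorant, along a filter of functions with values in `[-1, 1]`, that is
essentially the largest one. -/
theorem exists_essential_minorant (P : Measure X) [IsProbabilityMeasure P]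
    (𝒰 : Filter (X → ℝ)) (h𝒰 : ∀ᶠ f in 𝒰, ∀ x, |f x| ≤ 1) :
    ∃ (l : ℕ → X → ℝ) (g : X → ℝ),
      (∀ n, Measurable (l n) ∧ (∀ x, |l n x| ≤ 1) ∧ ∀ᶠ f in 𝒰, l n ≤ᵐ[P] f) ∧
      (∀ x, Tendsto (fun n => l n x) atTop (𝓝 (g x))) ∧
      ∀ A : Set X, MeasurableSet A → ∀ c : ℝ, (∀ᶠ f in 𝒰, ∀ᵐ x ∂P, x ∈ A → c ≤ f x) →
        ∀ᵐ x ∂P, x ∈ A → min c 1 ≤ g x := by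
  classical
  obtain ⟨l, g, hl, hlim, hg⟩ := exists_tendsto_essSup P
    (L := {a | Measurable a ∧ (∀ x, |a x| ≤ 1) ∧ ∀ᶠ f in 𝒰, a ≤ᵐ[P] f})
    ⟨fun _ => -1, measurable_const, by simp, h𝒰.mono fun f hf =>
      .of_forall fun x => (abs_le.1 (hf x)).1⟩
    (fun a ⟨ham, hab, hae⟩ b ⟨hbm, hbb, hbe⟩ => ⟨ham.sup hbm, fun x => abs_max_le_max_abs_abs.trans
      (max_le (hab x) (hbb x)), (hae.and hbe).mono fun f hf => by
        filter_upwards [hf.1, hf.2] with x h1 h2 using sup_le h1 h2⟩)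
    (fun a ha => ha.1) fun a ha => ha.2.1
  refine ⟨l, g, hl, hlim, fun A hA c hc => ?_⟩
  have hmem := hg (A.piecewise (fun _ => max (-1) (min c 1)) fun _ => -1)
    ⟨measurable_const.piecewise hA measurable_const, fun x => ?_, ?_⟩
  · filter_upwards [hmem] with x hx hxA
    rw [Set.piecewise_eq_of_mem _ _ _ hxA] at hx
    exact (le_max_right _ _).trans hx
  · by_cases hx : x ∈ A
    · rw [Set.piecewise_eq_of_mem _ _ _ hx]
      exact abs_le.2 ⟨le_max_left _ _, max_le (by norm_num) (min_le_right _ _)⟩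
    · simp [hx]
  · filter_upwards [hc, h𝒰] with f hf hfb
    filter_upwards [hf] with x hx
    by_cases hxA : x ∈ A
    · rw [Set.piecewise_eq_of_mem _ _ _ hxA]
      exact max_le (abs_le.1 (hfb x)).1 ((min_le_left _ _).trans (hx hxA))
    · rw [Set.piecewise_eq_of_notMem _ _ _ hxA]
      exact (abs_le.1 (hfb x)).1

/-- If an ultrafilter of functions contains no small bracket, there are a level `α` and a
nonnull set `B` such that each nonnull measurable subset of `B` is split at level `α` with gap
`γ` by almost all functions. -/
theorem exists_critical_set (P : Measure X) [IsProbabilityMeasure P] (𝒰 : Ultrafilter (X → ℝ))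
    (h𝒰 : ∀ᶠ f in (𝒰 : Filter (X → ℝ)), ∀ x, |f x| ≤ 1) {γ η : ℝ} (hγ : 0 < γ) (hγη : 2 * γ < η)
    (hbr : ∀ p ∈ smallBrackets P η, aeBracket P p ∉ 𝒰) :
    ∃ (α : ℝ) (B : Set X), MeasurableSet B ∧ P B ≠ 0 ∧
      ∀ A ⊆ B, MeasurableSet A → P A ≠ 0 → ∀ᶠ f in (𝒰 : Filter (X → ℝ)),
        P {x ∈ A | α + γ < f x} ≠ 0 ∧ P {x ∈ A | f x < α - γ} ≠ 0 := by
  obtain ⟨l, g, hl, hlim, hg⟩ := exists_essential_minorant P 𝒰 h𝒰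
  obtain ⟨v, k, hv, hvlim, hk⟩ := exists_essential_minorant P
    ((𝒰 : Filter (X → ℝ)).map Neg.neg) (by simpa using h𝒰)
  have hgm : Measurable g := measurable_of_tendsto_metrizable (fun n => (hl n).1)
    (tendsto_pi_nhds.2 hlim)
  have hkm : Measurable k := measurable_of_tendsto_metrizable (fun n => (hv n).1)
    (tendsto_pi_nhds.2 hvlim)
  have hgb (x : X) : |g x| ≤ 1 := le_of_tendsto' (hlim x).abs fun n => (hl n).2.1 x
  have hkb (x : X) : |k x| ≤ 1 := le_of_tendsto' (hvlim x).abs fun n => (hv n).2.1 x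
  have hlarge (n : ℕ) : η ≤ ∫ x, (-v n x - l n x) ∂P := by
    by_contra! hlt
    refine hbr (l n, fun x => -v n x) ⟨(hl n).1, (hv n).1.neg, (hl n).2.1,
      fun x => by simpa using (hv n).2.1 x, hlt.le⟩ ?_
    filter_upwards [(hl n).2.2, eventually_map.1 (hv n).2.2] with f h1 h2
    refine ⟨h1, ?_⟩
    filter_upwards [h2] with x hx
    exact le_neg.1 hx
  have hlargeLim : η ≤ ∫ x, (-k x - g x) ∂P := by
    refine ge_of_tendsto' (tendsto_integral_of_dominated_convergence (fun _ => (2 : ℝ))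
      (fun n => ((hv n).1.neg.sub (hl n).1).aestronglyMeasurable) (integrable_const _)
      (fun n => .of_forall fun x => ?_) (.of_forall fun x => (hvlim x).neg.sub (hlim x))) hlarge
    have h1 := abs_le.1 ((hl n).2.1 x)
    have h2 := abs_le.1 ((hv n).2.1 x)
    change |-v n x - l n x| ≤ 2
    rw [abs_le]
    constructor <;> linarith
  have hlevel : ∃ q : ℚ, P {x | g x < q - γ ∧ k x < -q - γ} ≠ 0 := by
    by_contra! hnull
    have hae : ∀ᵐ x ∂P, ∀ q : ℚ, ¬ (g x < q - γ ∧ k x < -q - γ) :=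
      ae_all_iff.2 fun q => ae_iff.2 (by simpa only [not_not] using hnull q)
    have hle : ∫ x, (-k x - g x) ∂P ≤ ∫ _, 2 * γ ∂P := by
      refine integral_mono_ae ((integrable_of_abs_le_one hkm hkb).neg.sub
        (integrable_of_abs_le_one hgm hgb)) (integrable_const _) ?_
      filter_upwards [hae] with x hx
      by_contra! hlt
      obtain ⟨q, h1, h2⟩ := exists_rat_btwn (show g x + γ < -k x - γ by linarith)
      exact hx q ⟨by linarith, by linarith⟩
    simp only [integral_const, probReal_univ, smul_eq_mul, one_mul] at hle
    linarith
  obtain ⟨q, hq⟩ := hlevel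
  refine ⟨q, _, (measurableSet_lt hgm measurable_const).inter
    (measurableSet_lt hkm measurable_const), hq, fun A hAB hA hPA => ?_⟩
  have habove : ∀ᶠ f in (𝒰 : Filter (X → ℝ)), ¬ ∀ᵐ x ∂P, x ∈ A → -(q : ℝ) - γ ≤ -f x := by
    rw [Ultrafilter.eventually_not]
    intro hev
    refine hPA (measure_mono_null (fun x hxA => ?_)
      (ae_iff.1 (hk A hA (-q - γ) (eventually_map.2 hev))))
    intro hx
    obtain ⟨h1, h2⟩ := hAB hxA
    rcases min_le_iff.1 (hx hxA) with h | h
    · exact absurd h (not_le.2 h2)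
    · have h1' : g x < q - γ := h1
      have h2' : k x < -q - γ := h2
      linarith [(abs_le.1 (hgb x)).1]
  have hbelow : ∀ᶠ f in (𝒰 : Filter (X → ℝ)), ¬ ∀ᵐ x ∂P, x ∈ A → (q : ℝ) - γ ≤ f x := by
    rw [Ultrafilter.eventually_not]
    intro hev
    refine hPA (measure_mono_null (fun x hxA => ?_) (ae_iff.1 (hg A hA (q - γ) hev)))
    intro hx
    obtain ⟨h1, h2⟩ := hAB hxA
    rcases min_le_iff.1 (hx hxA) with h | h
    · exact absurd h (not_le.2 h1)
    · have h1' : g x < q - γ := h1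
      have h2' : k x < -q - γ := h2
      linarith [(abs_le.1 (hkb x)).1]
  filter_upwards [habove, hbelow] with f h1 h2
  constructor
  · refine fun h0 => h1 (ae_iff.2 (measure_mono_null (fun x hx => ?_) h0))
    have hx' : ¬ (x ∈ A → -(q : ℝ) - γ ≤ -f x) := hx
    push Not at hx'
    exact ⟨hx'.1, by linarith [hx'.2]⟩
  · refine fun h0 => h2 (ae_iff.2 (measure_mono_null (fun x hx => ?_) h0))
    have hx' : ¬ (x ∈ A → (q : ℝ) - γ ≤ f x) := hx
    push Not at hx'
    exact hx'

/-- The points of `B` at which the functions `f i`, `i ∈ t`, exceed `α + γ` for `i ∈ s` and are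
below `α - γ` for `i ∉ s`. -/
def patternCell {ι : Type*} (B : Set X) (α γ : ℝ) (f : ι → X → ℝ) (t s : Finset ι) : Set X :=
  {x ∈ B | ∀ i ∈ t, (i ∈ s → α + γ < f i x) ∧ (i ∉ s → f i x < α - γ)}

theorem measurableSet_patternCell {ι : Type*} {B : Set X} (hB : MeasurableSet B) {α γ : ℝ}
    {f : ι → X → ℝ} {t : Finset ι} (s : Finset ι) (hf : ∀ i ∈ t, Measurable (f i)) :
    MeasurableSet (patternCell B α γ f t s) := by
  have heq : patternCell B α γ f t s =
      B ∩ ⋂ i ∈ t, {x | (i ∈ s → α + γ < f i x) ∧ (i ∉ s → f i x < α - γ)} := by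
    ext x
    simp [patternCell]
  rw [heq]
  refine hB.inter (Finset.measurableSet_biInter t fun i hi => ?_)
  by_cases his : i ∈ s
  · simpa [his] using measurableSet_lt measurable_const (hf i hi)
  · simpa [his] using measurableSet_lt (hf i hi) measurable_const

/-- On a critical set one finds functions realizing all patterns. -/
theorem exists_independent_of_critical {ι : Type*} [DecidableEq ι] {P : Measure X}
    {G : Filter (X → ℝ)} [G.NeBot] {F : Set (X → ℝ)} (hF : F ∈ G)
    (hFm : ∀ f ∈ F, Measurable f) {α γ : ℝ} {B : Set X} (hB : MeasurableSet B) (hPB : P B ≠ 0)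
    (hsplit : ∀ A ⊆ B, MeasurableSet A → P A ≠ 0 → ∀ᶠ f in G,
      P {x ∈ A | α + γ < f x} ≠ 0 ∧ P {x ∈ A | f x < α - γ} ≠ 0) (t : Finset ι) :
    ∃ f : ι → X → ℝ, (∀ i ∈ t, f i ∈ F) ∧ ∀ s ⊆ t, P (patternCell B α γ f t s) ≠ 0 := by
  induction t using Finset.induction_on with
  | empty => exact ⟨fun _ _ => 0, by simp, fun s _ => by simpa [patternCell] using hPB⟩
  | insert a t hat ih =>
    obtain ⟨f, hfF, hf⟩ := ih
    have hev : ∀ᶠ g in G, ∀ s ∈ t.powerset,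
        P {x ∈ patternCell B α γ f t s | α + γ < g x} ≠ 0 ∧
        P {x ∈ patternCell B α γ f t s | g x < α - γ} ≠ 0 :=
      (Finset.eventually_all _).2 fun s hs => hsplit _ (fun x hx => hx.1)
        (measurableSet_patternCell hB s fun i hi => hFm _ (hfF i hi))
        (hf s (Finset.mem_powerset.1 hs))
    obtain ⟨g, hg, hgF⟩ := (hev.and hF).exists
    refine ⟨Function.update f a g, fun i hi => ?_, fun s hs => ?_⟩
    · rcases Finset.mem_insert.1 hi with rfl | hi
      · rwa [Function.update_self]
      · rw [Function.update_of_ne (ne_of_mem_of_not_mem hi hat)]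
        exact hfF i hi
    · have hst : s.erase a ⊆ t := fun i hi =>
        (Finset.mem_insert.1 (hs (Finset.mem_of_mem_erase hi))).resolve_left
          (Finset.ne_of_mem_erase hi)
      obtain ⟨habove, hbelow⟩ := hg _ (Finset.mem_powerset.2 hst)
      have hold {x : X} (hx : x ∈ patternCell B α γ f t (s.erase a)) (i : ι) (hi : i ∈ t) :
          (i ∈ s → α + γ < Function.update f a g i x) ∧
            (i ∉ s → Function.update f a g i x < α - γ) := by
        have hia : i ≠ a := ne_of_mem_of_not_mem hi hat
        rw [Function.update_of_ne hia]
        simpa [hia] using hx.2 i hi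
      by_cases has : a ∈ s
      · refine fun h0 => habove (measure_mono_null ?_ h0)
        refine fun x hx => ⟨hx.1.1, fun i hi => ?_⟩
        rcases Finset.mem_insert.1 hi with rfl | hi
        · simpa [has] using hx.2
        · exact hold hx.1 i hi
      · refine fun h0 => hbelow (measure_mono_null ?_ h0)
        refine fun x hx => ⟨hx.1.1, fun i hi => ?_⟩
        rcases Finset.mem_insert.1 hi with rfl | hi
        · simpa [has] using hx.2
        · exact hold hx.1 i hi

end Critical

/-- If `2 ^ k` functions realize all patterns, then they shatter some `k` points. -/
theorem exists_gammaShatters_of_patterns {X : Type*} {F : Set (X → ℝ)} {α γ : ℝ} (hγ : 0 < γ)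
    {k : ℕ} (f : Finset (Fin k) → X → ℝ) (hfF : ∀ i, f i ∈ F)
    (hf : ∀ s : Finset (Finset (Fin k)), ∃ x, ∀ i,
      (i ∈ s → α + γ < f i x) ∧ (i ∉ s → f i x < α - γ)) :
    ∃ D : Finset X, D.card = k ∧ GammaShatters F γ D := by
  classical
  choose x hx using fun j : Fin k => hf (Finset.univ.filter (j ∈ ·))
  simp only [Finset.mem_filter, Finset.mem_univ, true_and] at hx
  have hinj : Function.Injective x := by
    intro j j' hjj'
    by_contra hne
    have h1 := (hx j {j}).1 (by simp)
    have h2 := (hx j' {j}).2 (by simpa using Ne.symm hne)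
    rw [← hjj'] at h2
    linarith
  refine ⟨Finset.univ.image x, by simp [Finset.card_image_of_injective _ hinj], α, fun D₀ hD₀ =>
    ⟨f (Finset.univ.filter (x · ∈ D₀)), hfF _, fun y hy => ?_, fun y hy hy' => ?_⟩⟩
  · obtain ⟨j, -, rfl⟩ := Finset.mem_image.1 (hD₀ hy)
    exact (hx j _).1 (by simpa using hy)
  · obtain ⟨j, -, rfl⟩ := Finset.mem_image.1 hy
    exact (hx j _).2 (by simpa using hy')

theorem gap_dimension_infinite_of_discrepancy_unitInterval
    {Ω : Type*} [MeasurableSpace Ω] (μ : Measure Ω) [IsProbabilityMeasure μ]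
    (T : Ω → Ω) (ξ : Ω → unitInterval) (hT : Ergodic T μ) (hξ : Measurable ξ)
    (hmarg : μ.map ξ = (volume : Measure unitInterval))
    (F : Set (unitInterval → ℝ)) (hFc : F.Countable)
    (hFm : ∀ f ∈ F, Measurable f)
    (hFb : ∀ f ∈ F, ∀ x, f x ∈ Set.Icc (0 : ℝ) 1)
    (η : ℝ) (hη : 0 < η)
    (hΓ : ∀ᵐ ω ∂μ, η < Filter.limsup (fun m : ℕ => discrepancy μ T ξ F m ω) Filter.atTop) :
    ∀ γ : ℝ, 0 < γ → γ ≤ η / 10 → ∀ k : ℕ,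
      ∃ D : Finset unitInterval, D.card = k ∧ GammaShatters F γ D := by
  intro γ hγ hγη k
  have : IsProbabilityMeasure (μ.map ξ) := Measure.isProbabilityMeasure_map hξ.aemeasurable
  have hFb' : ∀ f ∈ F, ∀ x, |f x| ≤ 1 := fun f hf x =>
    abs_le.2 ⟨by linarith [(hFb f hf x).1], (hFb f hf x).2⟩
  obtain ⟨𝒰, hF𝒰, hbr⟩ := exists_ultrafilter_forall_notMem F (smallBrackets (μ.map ξ) η)
    (aeBracket (μ.map ξ)) fun B hBη hB hcover => by
      obtain ⟨ω, h1, h2⟩ :=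
        (hΓ.and (ae_limsup_discrepancy_le hT hξ hFc hFm hFb' hη.le hB hBη hcover)).exists
      exact absurd h1 (not_lt.2 h2)
  obtain ⟨α, B, hB, hPB, hsplit⟩ := exists_critical_set (μ.map ξ) 𝒰
    (mem_of_superset hF𝒰 hFb') hγ (by linarith) hbr
  obtain ⟨f, hfF, hf⟩ := exists_independent_of_critical hF𝒰 hFm hB hPB hsplit
    (Finset.univ : Finset (Finset (Fin k)))
  refine exists_gammaShatters_of_patterns (α := α) hγ f (fun i => hfF i (Finset.mem_univ i)) fun s => ?_
  obtain ⟨x, hx⟩ := nonempty_of_measure_ne_zero (hf s (Finset.subset_univ s))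
  exact ⟨x, fun i => hx.2 i (Finset.mem_univ i)⟩
end
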